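/- Fix γ ∈ [0,1/2) and n, m ∈ ℕ with n > m. Let ε ≤ 2^{−m−1}, let Δ ∈ (0,1) be such that λ_γ + Δ < 1, and let 0 < c < 1. If f is drawn uniformly at random from F*_ε, then with probability at least 1 − 2^{−m·2^{n − c·m·log₂(1/(λ_γ+Δ))}} the function f has the following property: for every q ∈ ℕ with 2q < n − c·m·log₂(1/(λ_γ+Δ)) + log₂( (1−(λ_γ+Δ)^{1−c}) · log₂((λ_γ+Δ)/λ_γ) / (8·log₂(1/Δ)) ), every q-qubit strategy S for QPV_BB84^{f:n→m} satisfies ω_S ≤ (λ_γ+Δ)^{c·m} · (1 + 3·√(3·ln(2/ε))·2^{−n+m/2}) + 21·Δ^m. -/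

import Mathlib

open Matrix Kronecker Finset
open scoped ComplexOrder

noncomputable section

/-- Bit strings of length `n`. -/
abbrev Bits (n : ℕ) := Fin n → Bool

/-- Binary entropy function `h(p) = -p log₂ p - (1-p) log₂ (1-p)` (with `h 0 = 0`). -/
def binEnt (p : ℝ) : ℝ := -(p * Real.logb 2 p) - (1 - p) * Real.logb 2 (1 - p)

/-- `λ_γ = 2^{h(γ)} (1/2 + 1/(2√2))`. -/
def lamGamma (γ : ℝ) : ℝ := (2 : ℝ) ^ binEnt γ * (1 / 2 + 1 / (2 * Real.sqrt 2))

/-- Standard basis vector `|a⟩` of `ℂ²`. -/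
def ket (a : Bool) : Bool → ℂ := fun j => if j = a then 1 else 0

/-- The vector `H^z |a⟩` of `ℂ²`, where `H` is the 2×2 Hadamard matrix. -/
def hadVec (z a : Bool) : Bool → ℂ :=
  if z then fun j => (if j && a then (-1 : ℂ) else 1) / (Real.sqrt 2 : ℂ) else ket a

/-- The unit vector `⊗_{i} H^{z_i}|a_i⟩` of `(ℂ²)^{⊗ m}`. -/
def bb84Vec {m : ℕ} (z a : Bits m) : Bits m → ℂ := fun j => ∏ i, hadVec (z i) (a i) (j i)

/-- `M^z_a`: the rank-one orthogonal projector onto `⊗_i H^{z_i}|a_i⟩`. -/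
def Mproj {m : ℕ} (z a : Bits m) : Matrix (Bits m) (Bits m) ℂ :=
  vecMulVec (bb84Vec z a) (star (bb84Vec z a))

/-- A POVM: a family of positive semidefinite matrices summing to the identity. -/
def IsPOVM {d : Type*} [Fintype d] [DecidableEq d] {ι : Type*} [Fintype ι]
    (A : ι → Matrix d d ℂ) : Prop :=
  (∀ a, (A a).PosSemidef) ∧ ∑ a, A a = 1


/-- `q_f(z)`: the fraction of input pairs `(x,y)` mapped by `f` to `z`. -/
def qf (n m : ℕ) (f : Bits n × Bits n → Bits m) (z : Bits m) : ℝ :=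
  ((Finset.univ.filter (fun p : Bits n × Bits n => f p = z)).card : ℝ) / 2 ^ (2 * n)

/-- The set `F*_ε` of functions whose output distribution is close to uniform. -/
def Fstar (n m : ℕ) (ε : ℝ) : Set (Bits n × Bits n → Bits m) :=
  {f | ∀ z : Bits m,
    |qf n m f z - (2 : ℝ) ^ (-(m : ℝ))| ≤
      Real.sqrt (3 * Real.log (2 / ε)) * (2 : ℝ) ^ (-(n : ℝ) - m / 2)}

/-- A `q`-qubit strategy for `QPV_BB84^{f:n→m}`: a splitting of `q` qubits on each side
into kept/communicated registers, a shared state `φ`, local unitaries `U^x`, `V^y`, and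
response POVMs `A^{xy}`, `B^{xy}` on the regrouped registers. -/
structure BB84Strategy (n m q : ℕ) where
  qAk : ℕ
  qAc : ℕ
  qBk : ℕ
  qBc : ℕ
  hqA : qAk + qAc = q
  hqB : qBk + qBc = q
  φ : Bits m × (Bits qAk × Bits qAc) × (Bits qBk × Bits qBc) → ℂ
  hφ : ∑ i, ‖φ i‖ ^ 2 = 1
  U : Bits n → Matrix (Bits qAk × Bits qAc) (Bits qAk × Bits qAc) ℂ
  V : Bits n → Matrix (Bits qBk × Bits qBc) (Bits qBk × Bits qBc) ℂ
  hU : ∀ x, U x ∈ Matrix.unitaryGroup (Bits qAk × Bits qAc) ℂ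
  hV : ∀ y, V y ∈ Matrix.unitaryGroup (Bits qBk × Bits qBc) ℂ
  A : Bits n → Bits n → Bits m → Matrix (Bits qAk × Bits qBc) (Bits qAk × Bits qBc) ℂ
  B : Bits n → Bits n → Bits m → Matrix (Bits qBk × Bits qAc) (Bits qBk × Bits qAc) ℂ
  hA : ∀ x y, IsPOVM (A x y)
  hB : ∀ x y, IsPOVM (B x y)

/-- The state `ψ_{xy} = (I ⊗ U^x ⊗ V^y)φ`, viewed in `V ⊗ A' ⊗ B'` via the canonical
reordering of tensor factors (`A' = A_k ⊗ B_c`, `B' = B_k ⊗ A_c`). -/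
def BB84Strategy.psi {n m q : ℕ} (S : BB84Strategy n m q) (x y : Bits n) :
    Bits m × (Bits S.qAk × Bits S.qBc) × (Bits S.qBk × Bits S.qAc) → ℂ :=
  fun u =>
    (((1 : Matrix (Bits m) (Bits m) ℂ) ⊗ₖ (S.U x ⊗ₖ S.V y)).mulVec S.φ)
      (u.1, (u.2.1.1, u.2.2.2), (u.2.2.1, u.2.1.2))

/-- The winning probability `ω_S` of a strategy, with error tolerance `γ`. -/
def BB84Strategy.win {n m q : ℕ} (S : BB84Strategy n m q) (γ : ℝ)
    (f : Bits n × Bits n → Bits m) : ℝ :=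
  (1 / 2 ^ (2 * n) : ℝ) * ∑ x : Bits n, ∑ y : Bits n, ∑ a : Bits m,
    (star (S.psi x y) ⬝ᵥ ((Mproj (f (x, y)) a ⊗ₖ
        (∑ a' ∈ Finset.univ.filter
            (fun a' : Bits m => (hammingDist a a' : ℝ) ≤ γ * m),
          S.A x y a' ⊗ₖ S.B x y a')).mulVec (S.psi x y))).re

open MeasureTheory Metric in
/-- Volumetric bound on the size of an `η`-separated subset of the unit ball. -/
theorem card_le_of_separated_unitBall {E : Type*} [NormedAddCommGroup E] [NormedSpace ℝ E]
    [FiniteDimensional ℝ E] {η : ℝ} (hη : 0 < η) (s : Finset E) (hs : ∀ c ∈ s, ‖c‖ ≤ 1)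
    (h : ∀ c ∈ s, ∀ d ∈ s, c ≠ d → η ≤ ‖c - d‖) :
    (s.card : ℝ) ≤ (1 + 2 / η) ^ Module.finrank ℝ E := by
  borelize E
  let μ : Measure E := Measure.addHaar
  have hρ : 0 < 1 + η / 2 := by positivity
  have hδ : 0 < η / 2 := by positivity
  have D : Set.Pairwise (s : Set E) (Function.onFun Disjoint fun c => ball (c : E) (η / 2)) := by
    rintro c hc d hd hcd
    apply ball_disjoint_ball
    rw [dist_eq_norm, add_halves]
    exact h c hc d hd hcd
  have hsub : (⋃ c ∈ s, ball (c : E) (η / 2)) ⊆ ball (0 : E) (1 + η / 2) := by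
    refine Set.iUnion₂_subset fun x hx => ball_subset_ball' ?_
    rw [dist_zero_right]
    linarith [hs x hx]
  have I : (s.card : ENNReal) * ENNReal.ofReal ((η / 2) ^ Module.finrank ℝ E) * μ (ball 0 1) ≤
      ENNReal.ofReal ((1 + η / 2) ^ Module.finrank ℝ E) * μ (ball 0 1) := by
    have := measure_mono (μ := μ) hsub
    rw [measure_biUnion_finset D fun c _ => measurableSet_ball] at this
    simp only [μ.addHaar_ball_of_pos _ hδ, μ.addHaar_ball_of_pos _ hρ] at this
    simpa only [Finset.sum_const, nsmul_eq_mul, mul_assoc] using this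
  have J : (s.card : ENNReal) * ENNReal.ofReal ((η / 2) ^ Module.finrank ℝ E) ≤
      ENNReal.ofReal ((1 + η / 2) ^ Module.finrank ℝ E) :=
    (ENNReal.mul_le_mul_iff_left (measure_ball_pos _ _ zero_lt_one).ne' measure_ball_lt_top.ne).1 I
  have K := ENNReal.toReal_le_of_le_ofReal (pow_nonneg hρ.le _) J
  rw [ENNReal.toReal_mul, ENNReal.toReal_natCast, ENNReal.toReal_ofReal (by positivity),
    ← le_div_iff₀ (by positivity), ← div_pow] at K
  have hb : 1 + 2 / η = (1 + η / 2) / (η / 2) := by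
    field_simp
    ring
  rwa [hb]

/-- The unit ball of a finite-dimensional real normed space has an `η`-net of size at most
`(1 + 2 / η) ^ dim` consisting of points of the unit ball. -/
theorem exists_net_unitBall (E : Type*) [NormedAddCommGroup E] [NormedSpace ℝ E]
    [FiniteDimensional ℝ E] {η : ℝ} (hη : 0 < η) :
    ∃ s : Finset E, (∀ c ∈ s, ‖c‖ ≤ 1) ∧ (∀ x : E, ‖x‖ ≤ 1 → ∃ c ∈ s, ‖x - c‖ ≤ η) ∧
      (s.card : ℝ) ≤ (1 + 2 / η) ^ Module.finrank ℝ E := by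
  classical
  let P : ℕ → Prop := fun k => ∃ s : Finset E, s.card = k ∧ (∀ c ∈ s, ‖c‖ ≤ 1) ∧
    ∀ c ∈ s, ∀ d ∈ s, c ≠ d → η ≤ ‖c - d‖
  have hP0 : P 0 := ⟨∅, by simp⟩
  set M := ⌊(1 + 2 / η) ^ Module.finrank ℝ E⌋₊
  have hb : ∀ k, P k → k ≤ M := by
    rintro k ⟨s, rfl, h1, h2⟩
    exact Nat.le_floor (card_le_of_separated_unitBall hη s h1 h2)
  obtain ⟨s, hcard, h1, h2⟩ := Nat.findGreatest_spec (Nat.zero_le M) hP0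
  refine ⟨s, h1, fun x hx => ?_, card_le_of_separated_unitBall hη s h1 h2⟩
  by_contra! hcon
  have hxs : x ∉ s := fun hxs => by
    have := hcon x hxs
    simp only [sub_self, norm_zero] at this
    linarith
  have hP : P (s.card + 1) := by
    refine ⟨insert x s, Finset.card_insert_of_notMem hxs, ?_, ?_⟩
    · intro c hc
      rcases Finset.mem_insert.1 hc with rfl | hc
      exacts [hx, h1 c hc]
    · intro c hc d hd hcd
      rcases Finset.mem_insert.1 hc with hc' | hc' <;>
        rcases Finset.mem_insert.1 hd with hd' | hd'
      · exact absurd (hc'.trans hd'.symm) hcd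
      · exact hc' ▸ (hcon d hd').le
      · rw [norm_sub_rev]
        exact hd' ▸ (hcon c hc').le
      · exact h2 c hc' d hd' hcd
  have := Nat.le_findGreatest (hb _ hP) hP
  omega


/-- Exponential Markov inequality for a uniformly random function `P → Z`. -/
theorem card_filter_le_exp_mul_prod {P Z : Type*} [Fintype P] [DecidableEq P] [Fintype Z]
    [DecidableEq Z] (w : P → Z → ℝ) (t θ : ℝ) (s : Finset (P → Z))
    (hs : ∀ f ∈ s, t ≤ θ * ∑ p, w p (f p)) :
    (s.card : ℝ) ≤ Real.exp (-t) * ∏ p, ∑ z, Real.exp (θ * w p z) := by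
  have h1 : ∏ p, ∑ z, Real.exp (θ * w p z) = ∑ f : P → Z, ∏ p, Real.exp (θ * w p (f p)) := by
    rw [Finset.prod_univ_sum, Fintype.piFinset_univ]
  rw [h1, Finset.mul_sum]
  calc (s.card : ℝ) = ∑ f ∈ s, 1 := by simp
    _ ≤ ∑ f ∈ s, Real.exp (-t) * ∏ p, Real.exp (θ * w p (f p)) := by
        refine Finset.sum_le_sum fun f hf => ?_
        rw [← Real.exp_sum, ← Finset.mul_sum, ← Real.exp_add]
        exact Real.one_le_exp (by linarith [hs f hf])
    _ ≤ _ := Finset.sum_le_sum_of_subset_of_nonneg (Finset.subset_univ _)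
        fun _ _ _ => by positivity

/-- Chord bound for the exponential on `[0, 1]`. -/
theorem exp_mul_le_one_add {θ w : ℝ} (h0 : 0 ≤ w) (h1 : w ≤ 1) :
    Real.exp (θ * w) ≤ 1 + w * (Real.exp θ - 1) := by
  have := convexOn_exp.2 (Set.mem_univ 0) (Set.mem_univ θ) (sub_nonneg.2 h1) h0 (by ring)
  simp only [smul_eq_mul, mul_zero, zero_add, Real.exp_zero, mul_one] at this
  rw [mul_comm θ w]
  linarith

/-- Chernoff-type bound: if the weights `w p z ∈ [0, 1]` have mean at most `μ` over `z`, few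
functions `f` have average weight at least `T`. -/
theorem card_filter_le_chernoff {P Z : Type*} [Fintype P] [DecidableEq P] [Fintype Z]
    [DecidableEq Z] [Nonempty Z] (w : P → Z → ℝ) (μ T θ : ℝ) (hθ : 0 ≤ θ) (h0 : ∀ p z, 0 ≤ w p z)
    (h1 : ∀ p z, w p z ≤ 1) (hμ : ∀ p, ∑ z, w p z ≤ Fintype.card Z * μ)
    (s : Finset (P → Z)) (hs : ∀ f ∈ s, Fintype.card P * T ≤ ∑ p, w p (f p)) :
    (s.card : ℝ) ≤ (Fintype.card Z : ℝ) ^ Fintype.card P *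
      Real.exp (Fintype.card P * (μ * (Real.exp θ - 1) - θ * T)) := by
  have hZ : (0 : ℝ) < Fintype.card Z := by exact_mod_cast Fintype.card_pos
  have hexp : 0 ≤ Real.exp θ - 1 := by linarith [Real.one_le_exp hθ]
  refine (card_filter_le_exp_mul_prod w (θ * (Fintype.card P * T)) θ s fun f hf =>
    mul_le_mul_of_nonneg_left (hs f hf) hθ).trans ?_
  have h2 : ∏ p, ∑ z, Real.exp (θ * w p z) ≤
      ∏ _p : P, ((Fintype.card Z : ℝ) * Real.exp (μ * (Real.exp θ - 1))) := by
    refine Finset.prod_le_prod (fun p _ => by positivity) fun p _ => ?_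
    calc ∑ z, Real.exp (θ * w p z) ≤ ∑ z, (1 + w p z * (Real.exp θ - 1)) :=
          Finset.sum_le_sum fun z _ => exp_mul_le_one_add (h0 p z) (h1 p z)
      _ = Fintype.card Z + (∑ z, w p z) * (Real.exp θ - 1) := by
          simp [Finset.sum_add_distrib, Finset.sum_mul]
      _ ≤ Fintype.card Z + (Fintype.card Z * μ) * (Real.exp θ - 1) := by
          gcongr
          exact hμ p
      _ = Fintype.card Z * (μ * (Real.exp θ - 1) + 1) := by ring
      _ ≤ _ := by
          gcongr
          exact Real.add_one_le_exp _
  refine (mul_le_mul_of_nonneg_left h2 (Real.exp_nonneg _)).trans_eq ?_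
  rw [Finset.prod_const, mul_pow, Finset.card_univ, ← Real.exp_nat_mul, mul_left_comm,
    ← Real.exp_add]
  ring_nf

theorem exp_le_quadratic {x : ℝ} (hx : |x| ≤ 1 / 6) : Real.exp x ≤ 1 + x + 3 / 4 * x ^ 2 := by
  have h := Real.exp_bound (x := x) (n := 3) (by linarith) (by norm_num)
  simp only [Finset.sum_range_succ, Finset.sum_range_zero] at h
  norm_num [Nat.factorial] at h
  have h2 := (abs_le.1 h).2
  have h3 : |x| ^ 3 ≤ 1 / 6 * x ^ 2 := by
    rw [← sq_abs x]
    nlinarith [mul_le_mul_of_nonneg_right hx (sq_nonneg |x|)]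
  nlinarith [sq_nonneg x]

/-- Two-sided Chernoff bound for the number of preimages of `z` under a uniformly random
function. -/
theorem card_filter_preimage_le {P Z : Type*} [Fintype P] [DecidableEq P] [Fintype Z]
    [DecidableEq Z] [Nonempty Z] (z : Z) (δ : ℝ) (hδ0 : 0 ≤ δ) (hδ : δ ≤ 1 / 4) (s : Finset (P → Z))
    (hs : ∀ f ∈ s, δ * (Fintype.card P / Fintype.card Z) ≤
      |((Finset.univ.filter fun p => f p = z).card : ℝ) - Fintype.card P / Fintype.card Z|) :
    (s.card : ℝ) ≤ (Fintype.card Z : ℝ) ^ Fintype.card P *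
      (2 * Real.exp (-(δ ^ 2 * (Fintype.card P / Fintype.card Z) / 3))) := by
  have hZ : (0 : ℝ) < Fintype.card Z := by exact_mod_cast Fintype.card_pos
  set N : ℝ := (Fintype.card P : ℝ) with hN
  set D : ℝ := (Fintype.card Z : ℝ) with hD
  let w : P → Z → ℝ := fun _ y => if y = z then 1 else 0
  have hw : ∀ f : P → Z, ∑ p, w p (f p) = ((Finset.univ.filter fun p => f p = z).card : ℝ) := by
    intro f
    simp [w]
  have key : ∀ σ : ℝ, |σ| = 1 → ∀ s' : Finset (P → Z),
      (∀ f ∈ s', δ * (N / D) ≤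
        σ * (((Finset.univ.filter fun p => f p = z).card : ℝ) - N / D)) →
      (s'.card : ℝ) ≤ D ^ Fintype.card P * Real.exp (-(δ ^ 2 * (N / D) / 3)) := by
    intro σ hσ s' hs'
    have hσ2 : σ ^ 2 = 1 := by rw [← sq_abs, hσ, one_pow]
    set θ : ℝ := σ * (2 / 3 * δ) with hθ
    have hmain := card_filter_le_exp_mul_prod w (2 / 3 * δ * (δ * (N / D)) + θ * (N / D)) θ s'
      (by
        intro f hf
        rw [hw, hθ]
        have := mul_le_mul_of_nonneg_left (hs' f hf) (by positivity : 0 ≤ 2 / 3 * δ)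
        linarith)
    refine hmain.trans ?_
    have hquad : Real.exp θ - 1 ≤ θ + δ ^ 2 / 3 := by
      have := exp_le_quadratic (x := θ) (by
        rw [hθ, abs_mul, hσ, abs_of_nonneg (by positivity)]
        linarith)
      have h2 : θ ^ 2 = 4 / 9 * δ ^ 2 := by
        rw [hθ, mul_pow, hσ2]
        ring
      rw [h2] at this
      linarith
    have hsum : ∀ p : P, ∑ y, Real.exp (θ * w p y) = D * (1 + (Real.exp θ - 1) / D) := by
      intro p
      have : ∀ y, Real.exp (θ * w p y) = 1 + if y = z then Real.exp θ - 1 else 0 := by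
        intro y
        by_cases hy : y = z <;> simp [w, hy]
      simp only [this, Finset.sum_add_distrib, Finset.sum_ite_eq', Finset.mem_univ, if_true]
      field_simp
      simp [hD]
    simp only [hsum, Finset.prod_const, Finset.card_univ]
    have hpos : 0 ≤ 1 + (Real.exp θ - 1) / D := by
      have hD1 : 1 ≤ D := by
        rw [hD]
        exact_mod_cast Fintype.card_pos (α := Z)
      have : 1 + (Real.exp θ - 1) / D = (D + (Real.exp θ - 1)) / D := by field_simp
      rw [this]
      refine div_nonneg ?_ hZ.le
      linarith [Real.exp_pos θ]
    calc Real.exp (-(2 / 3 * δ * (δ * (N / D)) + θ * (N / D))) *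
          (D * (1 + (Real.exp θ - 1) / D)) ^ Fintype.card P
        ≤ Real.exp (-(2 / 3 * δ * (δ * (N / D)) + θ * (N / D))) *
          (D * Real.exp ((θ + δ ^ 2 / 3) / D)) ^ Fintype.card P := by
          gcongr
          calc 1 + (Real.exp θ - 1) / D ≤ 1 + (θ + δ ^ 2 / 3) / D := by gcongr
            _ ≤ _ := by linarith [Real.add_one_le_exp ((θ + δ ^ 2 / 3) / D)]
      _ = D ^ Fintype.card P * Real.exp (-(δ ^ 2 * (N / D) / 3)) := by
          rw [mul_pow, ← Real.exp_nat_mul, mul_left_comm, ← Real.exp_add, ← hN]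
          ring_nf
  classical
  set s₁ := s.filter fun f => δ * (N / D) ≤
    1 * (((Finset.univ.filter fun p => f p = z).card : ℝ) - N / D) with hs₁
  set s₂ := s.filter fun f => δ * (N / D) ≤
    (-1) * (((Finset.univ.filter fun p => f p = z).card : ℝ) - N / D) with hs₂
  have hsub : s ⊆ s₁ ∪ s₂ := by
    intro f hf
    rw [Finset.mem_union, hs₁, hs₂, Finset.mem_filter, Finset.mem_filter]
    rcases le_abs.1 (hs f hf) with h | h
    · exact Or.inl ⟨hf, by linarith⟩
    · exact Or.inr ⟨hf, by linarith⟩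
  have h1 := key 1 (by simp) s₁ fun f hf => (Finset.mem_filter.1 hf).2
  have h2 := key (-1) (by simp) s₂ fun f hf => (Finset.mem_filter.1 hf).2
  have h3 : (s.card : ℝ) ≤ s₁.card + s₂.card := by
    exact_mod_cast (Finset.card_le_card hsub).trans (Finset.card_union_le _ _)
  linarith


/-- Overlap bound of single-qubit BB84 states. -/
def bitOverlap (z z' : Bool) : ℝ := if z = z' then 1 else 1 / Real.sqrt 2

theorem norm_sum_hadVec_le (z z' a b : Bool) :
    ‖∑ j, star (hadVec z a j) * hadVec z' b j‖ ≤ bitOverlap z z' := by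
  have h2 : (Real.sqrt 2 : ℂ) * Real.sqrt 2 = 2 := by
    rw [← Complex.ofReal_mul, Real.mul_self_sqrt zero_le_two, Complex.ofReal_ofNat]
  have h0 : (Real.sqrt 2 : ℂ) ≠ 0 := by
    intro h
    rw [h] at h2
    norm_num at h2
  have h4 : (Real.sqrt 2 : ℂ)⁻¹ * (Real.sqrt 2 : ℂ)⁻¹ = 1 / 2 := by
    rw [← mul_inv, h2, one_div]
  have h3 : |Real.sqrt 2| = Real.sqrt 2 := abs_of_nonneg (Real.sqrt_nonneg _)
  cases z <;> cases z' <;> cases a <;> cases b <;>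
    norm_num [hadVec, ket, bitOverlap, div_eq_mul_inv, h4, h3]

theorem sum_hadVec_mul_star (z j k : Bool) :
    ∑ a, hadVec z a j * star (hadVec z a k) = if j = k then 1 else 0 := by
  have h2 : (Real.sqrt 2 : ℂ) * Real.sqrt 2 = 2 := by
    rw [← Complex.ofReal_mul, Real.mul_self_sqrt zero_le_two, Complex.ofReal_ofNat]
  have h4 : (Real.sqrt 2 : ℂ)⁻¹ * (Real.sqrt 2 : ℂ)⁻¹ = 1 / 2 := by
    rw [← mul_inv, h2, one_div]
  cases z <;> cases j <;> cases k <;>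
    norm_num [hadVec, ket, div_eq_mul_inv, h4]

theorem sum_bits_prod {R : Type*} [CommSemiring R] {m : ℕ} (g : Fin m → Bool → R) :
    ∑ e : Bits m, ∏ i, g i (e i) = ∏ i, ∑ b, g i b := by
  rw [Finset.prod_univ_sum, Fintype.piFinset_univ]

/-- Overlap bound of BB84 states in bases `z` and `z'`. -/
def overlap {m : ℕ} (z z' : Bits m) : ℝ := ∏ i, bitOverlap (z i) (z' i)

theorem bitOverlap_nonneg (z z' : Bool) : 0 ≤ bitOverlap z z' := by
  unfold bitOverlap
  split_ifs <;> positivity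

theorem overlap_nonneg {m : ℕ} (z z' : Bits m) : 0 ≤ overlap z z' :=
  Finset.prod_nonneg fun _ _ => bitOverlap_nonneg _ _

theorem overlap_comm {m : ℕ} (z z' : Bits m) : overlap z z' = overlap z' z := by
  simp [overlap, bitOverlap, eq_comm]

theorem sum_overlap {m : ℕ} (z : Bits m) :
    ∑ z', overlap z z' = (1 + 1 / Real.sqrt 2) ^ m := by
  unfold overlap
  rw [sum_bits_prod fun i b => bitOverlap (z i) b]
  have : ∀ i : Fin m, ∑ b, bitOverlap (z i) b = 1 + 1 / Real.sqrt 2 := by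
    intro i
    cases z i <;> simp [bitOverlap, add_comm]
  simp only [this, Finset.prod_const, Finset.card_univ, Fintype.card_fin]

theorem norm_sum_bb84Vec_le {m : ℕ} (z z' a b : Bits m) :
    ‖∑ j, star (bb84Vec z a j) * bb84Vec z' b j‖ ≤ overlap z z' := by
  have : ∀ j, star (bb84Vec z a j) * bb84Vec z' b j =
      ∏ i, (star (hadVec (z i) (a i) (j i)) * hadVec (z' i) (b i) (j i)) := by
    intro j
    rw [bb84Vec, bb84Vec, star_prod, Finset.prod_mul_distrib]
  simp_rw [this]
  rw [sum_bits_prod fun i c => star (hadVec (z i) (a i) c) * hadVec (z' i) (b i) c, norm_prod]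
  exact Finset.prod_le_prod (fun _ _ => norm_nonneg _) fun i _ => norm_sum_hadVec_le _ _ _ _

theorem sum_Mproj {m : ℕ} (z : Bits m) : ∑ a, Mproj z a = 1 := by
  ext j k
  rw [Matrix.sum_apply]
  simp only [Mproj, vecMulVec_apply, Pi.star_apply, bb84Vec, star_prod,
    ← Finset.prod_mul_distrib]
  rw [sum_bits_prod fun i c => hadVec (z i) c (j i) * star (hadVec (z i) c (k i))]
  simp only [sum_hadVec_mul_star, Matrix.one_apply, funext_iff]
  rw [Finset.prod_ite_zero]
  simp

open scoped InnerProductSpace in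
open ContinuousLinearMap in
/-- Monogamy-of-entanglement bound for BB84 measurements on a tripartite state, in terms of the
Kraus operators `P z a` and `Q z a` of two commuting families of measurements. -/
theorem monogamy_bound {m : ℕ} {H : Type*} [NormedAddCommGroup H] [InnerProductSpace ℂ H]
    [CompleteSpace H] (P Q : Bits m → Bits m → H →L[ℂ] H)
    (hP : ∀ z x, ∑ a, ‖P z a x‖ ^ 2 = ‖x‖ ^ 2) (hQ : ∀ z x, ∑ a, ‖Q z a x‖ ^ 2 = ‖x‖ ^ 2)
    (hPQ : ∀ z a z' b, P z a * Q z' b = Q z' b * P z a)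
    (hPQ' : ∀ z a z' b, adjoint (P z a) * Q z' b = Q z' b * adjoint (P z a))
    (ψ : Bits m → H) :
    ∑ z, ∑ a, ‖P z a (Q z a (∑ j, star (bb84Vec z a j) • ψ j))‖ ^ 2 ≤
      (1 + 1 / Real.sqrt 2) ^ m * ∑ j, ‖ψ j‖ ^ 2 := by
  set ξ : Bits m → Bits m → H := fun z a => ∑ j, star (bb84Vec z a j) • ψ j
  set u : Bits m → Bits m → H := fun z a => P z a (Q z a (ξ z a)) with hu
  set y : Bits m → Bits m → H := fun z a => adjoint (Q z a) (adjoint (P z a) (u z a)) with hy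
  set Ξ : Bits m → H := fun j => ∑ z, ∑ a, bb84Vec z a j • y z a with hΞ
  set W := ∑ z, ∑ a, ‖u z a‖ ^ 2 with hW
  set c : ℝ := (1 + 1 / Real.sqrt 2) ^ m with hc
  have hc0 : 0 < c := by positivity
  have hadj : ∀ (T : Bits m → Bits m → H →L[ℂ] H), (∀ z x, ∑ a, ‖T z a x‖ ^ 2 = ‖x‖ ^ 2) →
      ∀ z a x, ‖adjoint (T z a) x‖ ^ 2 ≤ ‖x‖ ^ 2 := by
    intro T hT z a x
    have h1 : ‖T z a‖ ≤ 1 := by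
      refine ContinuousLinearMap.opNorm_le_bound _ zero_le_one fun v => ?_
      rw [one_mul]
      refine le_of_sq_le_sq ?_ (norm_nonneg _)
      rw [← hT z v]
      exact Finset.single_le_sum (f := fun a => ‖T z a v‖ ^ 2) (fun _ _ => by positivity)
        (Finset.mem_univ a)
    have h2 : ‖adjoint (T z a)‖ ≤ 1 := by
      rwa [LinearIsometryEquiv.norm_map]
    gcongr
    simpa using (adjoint (T z a)).le_of_opNorm_le h2 x
  have hpair : (W : ℂ) = ∑ j, ⟪Ξ j, ψ j⟫_ℂ := by
    have h1 : ∀ z a, ((‖u z a‖ ^ 2 : ℝ) : ℂ) =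
        ∑ j, star (bb84Vec z a j) * ⟪y z a, ψ j⟫_ℂ := by
      intro z a
      have : ⟪y z a, ξ z a⟫_ℂ = ((‖u z a‖ ^ 2 : ℝ) : ℂ) := by
        rw [hy, adjoint_inner_left, adjoint_inner_left]
        change ⟪u z a, u z a⟫_ℂ = _
        rw [inner_self_eq_norm_sq_to_K]
        norm_cast
      rw [← this, inner_sum]
      exact Finset.sum_congr rfl fun j _ => inner_smul_right _ _ _
    simp only [hΞ, sum_inner, inner_smul_left]
    rw [hW, Complex.ofReal_sum, Finset.sum_comm]
    refine Finset.sum_congr rfl fun z _ => ?_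
    rw [Complex.ofReal_sum, Finset.sum_comm]
    exact Finset.sum_congr rfl fun a _ => h1 z a
  have hyy : ∀ z a z' b, ‖⟪y z a, y z' b⟫_ℂ‖ ≤
      (‖Q z' b (adjoint (Q z a) (u z a))‖ ^ 2 + ‖P z a (adjoint (P z' b) (u z' b))‖ ^ 2) / 2 := by
    intro z a z' b
    have hQP : adjoint (Q z a) * adjoint (P z a) = adjoint (P z a) * adjoint (Q z a) := by
      have := congrArg adjoint (hPQ z a z a)
      simpa only [ContinuousLinearMap.mul_def, adjoint_comp] using this
    have h1 : ⟪y z a, y z' b⟫_ℂ =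
        ⟪Q z' b (adjoint (Q z a) (u z a)), P z a (adjoint (P z' b) (u z' b))⟫_ℂ := by
      have h2 : y z a = adjoint (P z a) (adjoint (Q z a) (u z a)) :=
        DFunLike.congr_fun hQP (u z a)
      have h3 : Q z' b (y z a) = adjoint (P z a) (Q z' b (adjoint (Q z a) (u z a))) := by
        rw [h2]
        exact (DFunLike.congr_fun (hPQ' z a z' b) (adjoint (Q z a) (u z a))).symm
      calc ⟪y z a, y z' b⟫_ℂ = ⟪Q z' b (y z a), adjoint (P z' b) (u z' b)⟫_ℂ :=
            adjoint_inner_right _ _ _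
        _ = _ := by rw [h3, adjoint_inner_left]
    rw [h1]
    refine (norm_inner_le_norm _ _).trans ?_
    nlinarith [sq_nonneg (‖Q z' b (adjoint (Q z a) (u z a))‖ -
      ‖P z a (adjoint (P z' b) (u z' b))‖)]
  have hyysum : ∀ z z', ∑ a, ∑ b, ‖⟪y z a, y z' b⟫_ℂ‖ ≤
      (∑ a, ‖u z a‖ ^ 2 + ∑ a, ‖u z' a‖ ^ 2) / 2 := by
    intro z z'
    refine (Finset.sum_le_sum fun a _ => Finset.sum_le_sum fun b _ => hyy z a z' b).trans ?_
    simp only [← Finset.sum_div, Finset.sum_add_distrib]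
    have h1 : ∑ a, ∑ b, ‖Q z' b (adjoint (Q z a) (u z a))‖ ^ 2 ≤ ∑ a, ‖u z a‖ ^ 2 := by
      refine Finset.sum_le_sum fun a _ => ?_
      rw [hQ]
      exact hadj Q hQ z a _
    have h2 : ∑ a, ∑ b, ‖P z a (adjoint (P z' b) (u z' b))‖ ^ 2 ≤ ∑ a, ‖u z' a‖ ^ 2 := by
      rw [Finset.sum_comm]
      refine Finset.sum_le_sum fun b _ => ?_
      rw [hP]
      exact hadj P hP z' b _
    linarith
  have hquad : ∑ j, ‖Ξ j‖ ^ 2 ≤ c * W := by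
    have h1 : ((∑ j, ‖Ξ j‖ ^ 2 : ℝ) : ℂ) = ∑ z, ∑ z', ∑ a, ∑ b,
        (∑ j, star (bb84Vec z a j) * bb84Vec z' b j) * ⟪y z a, y z' b⟫_ℂ := by
      have h2 : ∀ j, ((‖Ξ j‖ ^ 2 : ℝ) : ℂ) = ∑ z, ∑ z', ∑ a, ∑ b,
          (star (bb84Vec z a j) * bb84Vec z' b j) * ⟪y z a, y z' b⟫_ℂ := by
        intro j
        have : ((‖Ξ j‖ ^ 2 : ℝ) : ℂ) = ⟪Ξ j, Ξ j⟫_ℂ := by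
          rw [inner_self_eq_norm_sq_to_K]
          norm_cast
        rw [this]
        simp only [hΞ, sum_inner]
        simp only [inner_sum, inner_smul_left, inner_smul_right]
        refine Finset.sum_congr rfl fun z _ => ?_
        rw [Finset.sum_comm]
        refine Finset.sum_congr rfl fun z' _ => Finset.sum_congr rfl fun a _ =>
          Finset.sum_congr rfl fun b _ => ?_
        rw [Complex.star_def]
        ring
      rw [Complex.ofReal_sum]
      simp only [h2, Finset.sum_mul]
      rw [Finset.sum_comm]
      refine Finset.sum_congr rfl fun z _ => ?_
      rw [Finset.sum_comm]
      refine Finset.sum_congr rfl fun z' _ => ?_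
      rw [Finset.sum_comm]
      refine Finset.sum_congr rfl fun a _ => ?_
      rw [Finset.sum_comm]
    calc ∑ j, ‖Ξ j‖ ^ 2 = ‖((∑ j, ‖Ξ j‖ ^ 2 : ℝ) : ℂ)‖ := by
          rw [Complex.norm_real, Real.norm_of_nonneg (by positivity)]
      _ ≤ ∑ z, ∑ z', ∑ a, ∑ b, overlap z z' * ‖⟪y z a, y z' b⟫_ℂ‖ := by
          rw [h1]
          refine (norm_sum_le _ _).trans (Finset.sum_le_sum fun z _ => ?_)
          refine (norm_sum_le _ _).trans (Finset.sum_le_sum fun z' _ => ?_)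
          refine (norm_sum_le _ _).trans (Finset.sum_le_sum fun a _ => ?_)
          refine (norm_sum_le _ _).trans (Finset.sum_le_sum fun b _ => ?_)
          rw [norm_mul]
          exact mul_le_mul_of_nonneg_right (norm_sum_bb84Vec_le _ _ _ _) (norm_nonneg _)
      _ ≤ ∑ z, ∑ z', overlap z z' * ((∑ a, ‖u z a‖ ^ 2 + ∑ a, ‖u z' a‖ ^ 2) / 2) := by
          simp only [← Finset.mul_sum]
          exact Finset.sum_le_sum fun z _ => Finset.sum_le_sum fun z' _ =>
            mul_le_mul_of_nonneg_left (hyysum z z') (overlap_nonneg _ _)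
      _ = (∑ z, ∑ z', overlap z z' * ∑ a, ‖u z a‖ ^ 2) / 2 +
          (∑ z, ∑ z', overlap z z' * ∑ a, ‖u z' a‖ ^ 2) / 2 := by
          rw [← add_div]
          simp only [mul_div_assoc', mul_add, ← Finset.sum_div, Finset.sum_add_distrib]
      _ = c * W := by
          have h3 : ∑ z, ∑ z', overlap z z' * ∑ a, ‖u z a‖ ^ 2 = c * W := by
            simp only [← Finset.sum_mul, sum_overlap]
            rw [hW, Finset.mul_sum]
          have h4 : ∑ z, ∑ z', overlap z z' * ∑ a, ‖u z' a‖ ^ 2 = c * W := by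
            rw [Finset.sum_comm, ← h3]
            exact Finset.sum_congr rfl fun z _ => Finset.sum_congr rfl fun z' _ => by
              rw [overlap_comm]
          rw [h3, h4]
          ring
  have h1 : W ≤ ∑ j, ‖Ξ j‖ * ‖ψ j‖ := by
    calc W = ‖(W : ℂ)‖ := by
          rw [Complex.norm_real, Real.norm_of_nonneg (by positivity)]
      _ ≤ _ := by
        rw [hpair]
        exact (norm_sum_le _ _).trans (Finset.sum_le_sum fun j _ => norm_inner_le_norm _ _)
  have h2 : ∑ j, ‖Ξ j‖ * ‖ψ j‖ ≤ ∑ j, (‖Ξ j‖ ^ 2 / (2 * c) + c / 2 * ‖ψ j‖ ^ 2) := by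
    refine Finset.sum_le_sum fun j _ => ?_
    have : ‖Ξ j‖ ^ 2 / (2 * c) + c / 2 * ‖ψ j‖ ^ 2 - ‖Ξ j‖ * ‖ψ j‖ =
        (‖Ξ j‖ - c * ‖ψ j‖) ^ 2 / (2 * c) := by
      field_simp
      ring
    have h3 : 0 ≤ (‖Ξ j‖ - c * ‖ψ j‖) ^ 2 / (2 * c) := by positivity
    linarith
  rw [Finset.sum_add_distrib, ← Finset.sum_div, ← Finset.mul_sum] at h2
  have h3 : (∑ j, ‖Ξ j‖ ^ 2) / (2 * c) ≤ W / 2 := by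
    rw [div_le_div_iff₀ (by positivity) two_pos]
    linarith
  linarith


/-- Hamming weight of a bit string. -/
def weight {m : ℕ} (e : Bits m) : ℕ := (Finset.univ.filter fun i => e i = true).card

theorem prod_ite_weight {R : Type*} [CommSemiring R] {m : ℕ} (e : Bits m) (a b : R) :
    ∏ i, (if e i = true then a else b) = a ^ weight e * b ^ (m - weight e) := by
  rw [Finset.prod_ite, Finset.prod_const, Finset.prod_const, weight]
  congr 2
  have := Finset.card_filter_add_card_filter_not (s := (Finset.univ : Finset (Fin m)))
    (fun i => e i = true)
  rw [Finset.card_univ, Fintype.card_fin] at this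
  omega

theorem weight_le {m : ℕ} (e : Bits m) : weight e ≤ m := by
  simpa [weight] using Finset.card_filter_le (Finset.univ : Finset (Fin m)) fun i => e i = true

/-- Entropy bound on the volume of a Hamming ball. -/
theorem card_weight_le {γ : ℝ} (hγ0 : 0 ≤ γ) (hγ1 : γ < 1 / 2) (m : ℕ) :
    ((Finset.univ.filter fun e : Bits m => (weight e : ℝ) ≤ γ * m).card : ℝ) ≤
      ((2 : ℝ) ^ binEnt γ) ^ m := by
  rcases hγ0.eq_or_lt with rfl | hγ
  · have h1 : (Finset.univ.filter fun e : Bits m => (weight e : ℝ) ≤ 0 * m) ⊆ {fun _ => false} := by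
      intro e he
      have h2 := (Finset.mem_filter.1 he).2
      rw [zero_mul] at h2
      have h3 : weight e = 0 := by exact_mod_cast le_antisymm h2 (Nat.cast_nonneg _)
      rw [weight, Finset.card_eq_zero, Finset.filter_eq_empty_iff] at h3
      rw [Finset.mem_singleton]
      funext i
      simpa using h3 (Finset.mem_univ i)
    have h4 := Finset.card_le_card h1
    rw [Finset.card_singleton] at h4
    simp only [binEnt, zero_mul, sub_zero, Real.logb_one, mul_zero, neg_zero, Real.rpow_zero,
      one_pow] at h4 ⊢
    exact_mod_cast h4
  have h1γ : 0 < 1 - γ := by linarith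
  have hsum : ∑ e : Bits m, γ ^ weight e * (1 - γ) ^ (m - weight e) = 1 := by
    simp_rw [← prod_ite_weight]
    rw [sum_bits_prod (fun _ b => if b = true then γ else 1 - γ)]
    simp
  have hent : ((2 : ℝ) ^ binEnt γ) ^ m * (γ ^ (γ * m) * (1 - γ) ^ ((m : ℝ) - γ * m)) = 1 := by
    rw [← Real.rpow_natCast, ← Real.rpow_mul two_pos.le, Real.rpow_def_of_pos two_pos,
      Real.rpow_def_of_pos hγ, Real.rpow_def_of_pos h1γ, ← Real.exp_add, ← Real.exp_add,
      Real.exp_eq_one_iff, binEnt, Real.logb, Real.logb]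
    have : Real.log 2 ≠ 0 := (Real.log_pos one_lt_two).ne'
    field_simp
    ring
  have hpt : ∀ e ∈ Finset.univ.filter fun e : Bits m => (weight e : ℝ) ≤ γ * m,
      γ ^ (γ * m) * (1 - γ) ^ ((m : ℝ) - γ * m) ≤ γ ^ weight e * (1 - γ) ^ (m - weight e) := by
    intro e he
    have he := (Finset.mem_filter.1 he).2
    rw [← Real.rpow_natCast γ, ← Real.rpow_natCast (1 - γ), Nat.cast_sub (weight_le e),
      Real.rpow_def_of_pos hγ, Real.rpow_def_of_pos h1γ, Real.rpow_def_of_pos hγ,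
      Real.rpow_def_of_pos h1γ, ← Real.exp_add, ← Real.exp_add, Real.exp_le_exp]
    have : Real.log γ ≤ Real.log (1 - γ) := Real.log_le_log hγ (by linarith)
    nlinarith
  have h2 : ((Finset.univ.filter fun e : Bits m => (weight e : ℝ) ≤ γ * m).card : ℝ) *
      (γ ^ (γ * m) * (1 - γ) ^ ((m : ℝ) - γ * m)) ≤ 1 := by
    rw [← nsmul_eq_mul, ← Finset.sum_const]
    exact ((Finset.sum_le_sum hpt).trans (Finset.sum_le_sum_of_subset_of_nonneg
      (Finset.subset_univ _) fun _ _ _ => by positivity)).trans_eq hsum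
  exact le_of_mul_le_mul_right (h2.trans_eq hent.symm) (by positivity)

theorem lamGamma_ge {γ : ℝ} (hγ0 : 0 ≤ γ) (hγ1 : γ < 1 / 2) : 3 / 4 ≤ lamGamma γ := by
  have h0 : 0 ≤ binEnt γ := by
    rw [binEnt]
    have h1 : Real.logb 2 γ ≤ 0 := Real.logb_nonpos one_lt_two hγ0 (by linarith)
    have h2 : Real.logb 2 (1 - γ) ≤ 0 :=
      Real.logb_nonpos one_lt_two (by linarith) (by linarith)
    nlinarith
  have h1 : (1 : ℝ) ≤ 2 ^ binEnt γ := Real.one_le_rpow one_le_two h0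
  have h2 : Real.sqrt 2 ≤ 2 := by
    rw [Real.sqrt_le_left] <;> norm_num
  have h3 : (1 : ℝ) / 4 ≤ 1 / (2 * Real.sqrt 2) := by
    apply one_div_le_one_div_of_le (by positivity)
    linarith
  rw [lamGamma]
  nlinarith


theorem card_bits (n : ℕ) : (Fintype.card (Bits n) : ℝ) = 2 ^ n := by
  simp [Bits]

/-- At least half of all functions have an almost uniform output distribution. -/
theorem card_le_two_mul_ncard_Fstar {n m : ℕ} {ε : ℝ} (hε0 : 0 < ε)
    (hε : ε ≤ (2 : ℝ) ^ (-(m : ℝ) - 1))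
    (hregime : Real.sqrt (3 * Real.log (2 / ε)) * (2 : ℝ) ^ (-(n : ℝ) + m / 2) < 1 / 4) :
    ((2 : ℝ) ^ m) ^ Fintype.card (Bits n × Bits n) ≤ 2 * ((Fstar n m ε).ncard : ℝ) := by
  classical
  set δ : ℝ := Real.sqrt (3 * Real.log (2 / ε)) * (2 : ℝ) ^ (-(n : ℝ) + m / 2) with hδ
  have hε2 : ε ≤ 2 := hε.trans ((Real.rpow_le_rpow_of_exponent_le one_le_two
    (by linarith [(Nat.cast_nonneg m : (0 : ℝ) ≤ m)] : -(m : ℝ) - 1 ≤ 1)).trans_eq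
      (Real.rpow_one 2))
  have hlog : 0 ≤ Real.log (2 / ε) := Real.log_nonneg (by rwa [one_le_div hε0])
  have hP : (Fintype.card (Bits n × Bits n) : ℝ) = (2 : ℝ) ^ (2 * n) := by
    rw [Fintype.card_prod, Nat.cast_mul, card_bits]
    ring
  have hratio : (Fintype.card (Bits n × Bits n) : ℝ) / Fintype.card (Bits m) =
      (2 : ℝ) ^ (2 * (n : ℝ) - m) := by
    rw [hP, card_bits, Real.rpow_sub two_pos, ← Real.rpow_natCast 2 (2 * n), Real.rpow_natCast 2 m]
    push_cast
    rfl
  have hbad : ∀ z : Bits m, ((Finset.univ.filter fun f : Bits n × Bits n → Bits m =>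
      ¬ |qf n m f z - (2 : ℝ) ^ (-(m : ℝ))| ≤
        Real.sqrt (3 * Real.log (2 / ε)) * (2 : ℝ) ^ (-(n : ℝ) - m / 2)).card : ℝ) ≤
      ((2 : ℝ) ^ m) ^ Fintype.card (Bits n × Bits n) * ε := by
    intro z
    have := card_filter_preimage_le z δ (by positivity) hregime.le
      (Finset.univ.filter fun f : Bits n × Bits n → Bits m =>
        ¬ |qf n m f z - (2 : ℝ) ^ (-(m : ℝ))| ≤
        Real.sqrt (3 * Real.log (2 / ε)) * (2 : ℝ) ^ (-(n : ℝ) - m / 2)) (by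
        intro f hf
        have hf := (not_le.1 (Finset.mem_filter.1 hf).2).le
        have h1 : ((Finset.univ.filter fun p => f p = z).card : ℝ) -
            (Fintype.card (Bits n × Bits n) : ℝ) / Fintype.card (Bits m) =
            2 ^ (2 * n) * (qf n m f z - (2 : ℝ) ^ (-(m : ℝ))) := by
          rw [hP, card_bits, qf, Real.rpow_neg two_pos.le, Real.rpow_natCast]
          field_simp
        rw [h1, abs_mul, abs_of_pos (by positivity)]
        refine le_trans (le_of_eq ?_) (mul_le_mul_of_nonneg_left hf (by positivity))
        rw [hratio, hδ, ← Real.rpow_natCast 2 (2 * n), mul_assoc, ← Real.rpow_add two_pos,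
          mul_left_comm, ← Real.rpow_add two_pos]
        push_cast
        ring_nf)
    rw [card_bits] at this
    rw [← card_bits m] at this
    refine this.trans (le_of_eq ?_)
    have h2 : δ ^ 2 * (Fintype.card (Bits n × Bits n) / Fintype.card (Bits m)) / 3 =
        Real.log (2 / ε) := by
      rw [hratio, hδ, mul_pow, Real.sq_sqrt (by positivity), ← Real.rpow_natCast _ 2,
        ← Real.rpow_mul two_pos.le, mul_assoc, ← Real.rpow_add two_pos]
      have : (-(n : ℝ) + m / 2) * ((2 : ℕ) : ℝ) + (2 * n - m) = 0 := by
        push_cast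
        ring
      rw [this, Real.rpow_zero]
      ring
    rw [h2, Real.exp_neg, Real.exp_log (by positivity), card_bits]
    field_simp
  have hF : Fstar n m ε = ↑(Finset.univ.filter fun f : Bits n × Bits n → Bits m =>
      ∀ z, |qf n m f z - (2 : ℝ) ^ (-(m : ℝ))| ≤
        Real.sqrt (3 * Real.log (2 / ε)) * (2 : ℝ) ^ (-(n : ℝ) - m / 2)) := by
    ext f
    simp [Fstar]
  rw [hF, Set.ncard_coe_finset]
  set G := Finset.univ.filter fun f : Bits n × Bits n → Bits m =>
      ∀ z, |qf n m f z - (2 : ℝ) ^ (-(m : ℝ))| ≤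
        Real.sqrt (3 * Real.log (2 / ε)) * (2 : ℝ) ^ (-(n : ℝ) - m / 2) with hG
  have hcover : (Finset.univ : Finset (Bits n × Bits n → Bits m)) ⊆
      G ∪ Finset.univ.biUnion fun z => Finset.univ.filter fun f : Bits n × Bits n → Bits m =>
      ¬ |qf n m f z - (2 : ℝ) ^ (-(m : ℝ))| ≤
        Real.sqrt (3 * Real.log (2 / ε)) * (2 : ℝ) ^ (-(n : ℝ) - m / 2) := by
    intro f _
    by_cases hf : f ∈ G
    · exact Finset.mem_union_left _ hf
    · refine Finset.mem_union_right _ ?_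
      simpa [hG] using hf
  have hcard : (Fintype.card (Bits n × Bits n → Bits m) : ℝ) ≤ G.card +
      ∑ z : Bits m, ((Finset.univ.filter fun f : Bits n × Bits n → Bits m =>
      ¬ |qf n m f z - (2 : ℝ) ^ (-(m : ℝ))| ≤
        Real.sqrt (3 * Real.log (2 / ε)) * (2 : ℝ) ^ (-(n : ℝ) - m / 2)).card : ℝ) := by
    exact_mod_cast (Finset.card_le_card hcover).trans
      ((Finset.card_union_le _ _).trans (Nat.add_le_add_left Finset.card_biUnion_le _))
  have hsum := Finset.sum_le_sum fun (z : Bits m) (_ : z ∈ Finset.univ) => hbad z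
  rw [Finset.sum_const, Finset.card_univ, nsmul_eq_mul, card_bits] at hsum
  have hfun : (Fintype.card (Bits n × Bits n → Bits m) : ℝ) =
      ((2 : ℝ) ^ m) ^ Fintype.card (Bits n × Bits n) := by
    rw [Fintype.card_fun, Nat.cast_pow, card_bits]
  rw [hfun] at hcard
  have hmε : (2 : ℝ) ^ m * ε ≤ 1 / 2 := by
    calc (2 : ℝ) ^ m * ε ≤ 2 ^ m * (2 : ℝ) ^ (-(m : ℝ) - 1) := by gcongr
      _ = 1 / 2 := by
        rw [← Real.rpow_natCast, ← Real.rpow_add two_pos,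
          show (m : ℝ) + (-m - 1) = -1 by ring, Real.rpow_neg_one, one_div]
  have hpos : (0 : ℝ) < ((2 : ℝ) ^ m) ^ Fintype.card (Bits n × Bits n) := by positivity
  nlinarith [mul_le_mul_of_nonneg_left hmε hpos.le]


/-- Euclidean norm of a complex vector. -/
def vnorm {ι : Type*} [Fintype ι] (v : ι → ℂ) : ℝ := ‖(WithLp.toLp 2 v : EuclideanSpace ℂ ι)‖

theorem vnorm_nonneg {ι : Type*} [Fintype ι] (v : ι → ℂ) : 0 ≤ vnorm v := norm_nonneg _

theorem vnorm_sq {ι : Type*} [Fintype ι] (v : ι → ℂ) : vnorm v ^ 2 = ∑ i, ‖v i‖ ^ 2 :=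
  EuclideanSpace.norm_sq_eq _

theorem vnorm_add_le {ι : Type*} [Fintype ι] (v w : ι → ℂ) : vnorm (v + w) ≤ vnorm v + vnorm w :=
  norm_add_le (WithLp.toLp 2 v : EuclideanSpace ℂ ι) (WithLp.toLp 2 w)

theorem re_star_dotProduct_self {ι : Type*} [Fintype ι] (v : ι → ℂ) :
    (star v ⬝ᵥ v).re = vnorm v ^ 2 := by
  rw [vnorm_sq, dotProduct, Complex.re_sum]
  refine Finset.sum_congr rfl fun i _ => ?_
  rw [Pi.star_apply, Complex.star_def, ← Complex.normSq_eq_conj_mul_self, Complex.ofReal_re,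
    Complex.normSq_eq_norm_sq]

/-- The real part of the quadratic form of a matrix. -/
def qform {ι : Type*} [Fintype ι] (G : Matrix ι ι ℂ) (v : ι → ℂ) : ℝ :=
  (star v ⬝ᵥ G *ᵥ v).re

theorem qform_sub {ι : Type*} [Fintype ι] (G G' : Matrix ι ι ℂ) (v : ι → ℂ) :
    qform (G - G') v = qform G v - qform G' v := by
  simp [qform, sub_mulVec, dotProduct_sub]

theorem qform_sum {ι κ : Type*} [Fintype ι] (s : Finset κ) (G : κ → Matrix ι ι ℂ) (v : ι → ℂ) :
    qform (∑ k ∈ s, G k) v = ∑ k ∈ s, qform (G k) v := by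
  simp [qform, sum_mulVec, dotProduct_sum]

theorem qform_one {ι : Type*} [Fintype ι] [DecidableEq ι] (v : ι → ℂ) :
    qform 1 v = vnorm v ^ 2 := by
  rw [qform, one_mulVec, re_star_dotProduct_self]

theorem qform_conjTranspose_mul_self {ι κ : Type*} [Fintype ι] [Fintype κ] (F : Matrix κ ι ℂ)
    (v : ι → ℂ) : qform (Fᴴ * F) v = vnorm (F *ᵥ v) ^ 2 := by
  rw [qform, ← mulVec_mulVec, dotProduct_mulVec, vecMul_conjTranspose, star_star,
    re_star_dotProduct_self]

open scoped MatrixOrder Matrix.Norms.L2Operator in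
theorem exists_conjTranspose_mul_self {ι : Type*} [Fintype ι] [DecidableEq ι]
    {G : Matrix ι ι ℂ} (hG : G.PosSemidef) : ∃ F : Matrix ι ι ℂ, G = Fᴴ * F := by
  obtain ⟨F, hF⟩ := CStarAlgebra.nonneg_iff_eq_star_mul_self.mp hG.nonneg
  exact ⟨F, hF⟩

theorem qform_nonneg {ι : Type*} [Fintype ι] [DecidableEq ι] {G : Matrix ι ι ℂ}
    (hG : G.PosSemidef) (v : ι → ℂ) : 0 ≤ qform G v := by
  obtain ⟨F, rfl⟩ := exists_conjTranspose_mul_self hG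
  rw [qform_conjTranspose_mul_self]
  positivity

theorem qform_le_vnorm_sq {ι : Type*} [Fintype ι] [DecidableEq ι] {G : Matrix ι ι ℂ}
    (hG : (1 - G).PosSemidef) (v : ι → ℂ) : qform G v ≤ vnorm v ^ 2 := by
  have := qform_nonneg hG v
  rw [qform_sub, qform_one] at this
  linarith

theorem qform_le_add {ι : Type*} [Fintype ι] [DecidableEq ι] {G : Matrix ι ι ℂ}
    (hG : G.PosSemidef) (hG' : (1 - G).PosSemidef) {v w : ι → ℂ} (hv : vnorm v ≤ 1)
    (hw : vnorm w ≤ 1) : qform G v ≤ qform G w + 2 * vnorm (v - w) := by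
  obtain ⟨F, rfl⟩ := exists_conjTranspose_mul_self hG
  have hF : ∀ x, vnorm (F *ᵥ x) ≤ vnorm x := by
    intro x
    refine le_of_sq_le_sq ?_ (vnorm_nonneg _)
    rw [← qform_conjTranspose_mul_self]
    exact qform_le_vnorm_sq hG' x
  rw [qform_conjTranspose_mul_self, qform_conjTranspose_mul_self]
  have h1 : vnorm (F *ᵥ v) ≤ vnorm (F *ᵥ w) + vnorm (v - w) := by
    have h2 : F *ᵥ v = F *ᵥ w + F *ᵥ (v - w) := by
      rw [← mulVec_add, add_sub_cancel]
    calc vnorm (F *ᵥ v) ≤ vnorm (F *ᵥ w) + vnorm (F *ᵥ (v - w)) := by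
          rw [h2]
          exact vnorm_add_le _ _
      _ ≤ _ := by
          gcongr
          exact hF _
  nlinarith [hF v, hF w, vnorm_nonneg (F *ᵥ v), vnorm_nonneg (F *ᵥ w), vnorm_nonneg (v - w)]

/-- The operator whose expectation is the winning probability in bases `z` when the answers are
produced by the POVMs `A` and `B`. -/
def winOp {m : ℕ} {α β : Type*} (γ : ℝ) (z : Bits m) (A : Bits m → Matrix α α ℂ)
    (B : Bits m → Matrix β β ℂ) : Matrix (Bits m × (α × β)) (Bits m × (α × β)) ℂ :=
  ∑ a, Mproj z a ⊗ₖ ∑ a' ∈ Finset.univ.filter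
    (fun a' : Bits m => (hammingDist a a' : ℝ) ≤ γ * m), A a' ⊗ₖ B a'

theorem posSemidef_Mproj {m : ℕ} (z a : Bits m) : (Mproj z a).PosSemidef :=
  posSemidef_vecMulVec_self_star _

theorem kronecker_sum_right {α β κ : Type*} (M : Matrix α α ℂ) (s : Finset κ)
    (B : κ → Matrix β β ℂ) : M ⊗ₖ (∑ k ∈ s, B k) = ∑ k ∈ s, M ⊗ₖ B k := by
  ext i j
  simp [Matrix.sum_apply, Finset.mul_sum]

theorem kronecker_sum_left {α β κ : Type*} (M : Matrix β β ℂ) (s : Finset κ)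
    (B : κ → Matrix α α ℂ) : (∑ k ∈ s, B k) ⊗ₖ M = ∑ k ∈ s, B k ⊗ₖ M := by
  ext i j
  simp [Matrix.sum_apply, Finset.sum_mul]

theorem posSemidef_winOp {m : ℕ} {α β : Type*} [Fintype α] [DecidableEq α] [Fintype β]
    [DecidableEq β] (γ : ℝ) (z : Bits m) {A : Bits m → Matrix α α ℂ} {B : Bits m → Matrix β β ℂ}
    (hA : IsPOVM A) (hB : IsPOVM B) : (winOp γ z A B).PosSemidef :=
  posSemidef_sum _ fun a _ => (posSemidef_Mproj z a).kronecker
    (posSemidef_sum _ fun a' _ => (hA.1 a').kronecker (hB.1 a'))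

theorem posSemidef_one_sub_winOp {m : ℕ} {α β : Type*} [Fintype α] [DecidableEq α] [Fintype β]
    [DecidableEq β] (γ : ℝ) (z : Bits m) {A : Bits m → Matrix α α ℂ} {B : Bits m → Matrix β β ℂ}
    (hA : IsPOVM A) (hB : IsPOVM B) : (1 - winOp γ z A B).PosSemidef := by
  have h1 : ∀ a, (1 - B a).PosSemidef := by
    intro a
    rw [← hB.2, ← Finset.sum_erase_eq_sub (Finset.mem_univ a)]
    exact posSemidef_sum _ fun b _ => hB.1 b
  have h2 : ∀ s : Finset (Bits m), (1 - ∑ a ∈ s, A a ⊗ₖ B a).PosSemidef := by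
    intro s
    have : (1 - ∑ a ∈ s, A a ⊗ₖ B a) = ∑ a, A a ⊗ₖ (1 - if a ∈ s then B a else 0) := by
      have h4 : (1 : Matrix (α × β) (α × β) ℂ) = ∑ a, A a ⊗ₖ (1 : Matrix β β ℂ) := by
        rw [← kronecker_sum_left, hA.2, one_kronecker_one]
      have h5 : ∑ a ∈ s, A a ⊗ₖ B a = ∑ a, A a ⊗ₖ (if a ∈ s then B a else 0) := by
        have h6 : ∀ a, (A a ⊗ₖ if a ∈ s then B a else 0) = if a ∈ s then A a ⊗ₖ B a else 0 := by
          intro a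
          split_ifs
          · rfl
          · exact kronecker_zero _
        rw [Finset.sum_congr rfl fun a _ => h6 a, Finset.sum_ite_mem, Finset.univ_inter]
      rw [h4, h5, ← Finset.sum_sub_distrib]
      refine Finset.sum_congr rfl fun a _ => ?_
      ext i j
      simp [mul_sub]
    rw [this]
    refine posSemidef_sum _ fun a _ => (hA.1 a).kronecker ?_
    split_ifs
    · exact h1 a
    · rw [sub_zero]
      exact PosSemidef.one
  have h3 : 1 - winOp γ z A B = ∑ a, Mproj z a ⊗ₖ (1 - ∑ a' ∈ Finset.univ.filter
      (fun a' : Bits m => (hammingDist a a' : ℝ) ≤ γ * m), A a' ⊗ₖ B a') := by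
    have h4 : (1 : Matrix (Bits m × (α × β)) (Bits m × (α × β)) ℂ) =
        ∑ a, Mproj z a ⊗ₖ (1 : Matrix (α × β) (α × β) ℂ) := by
      rw [← kronecker_sum_left, sum_Mproj, one_kronecker_one]
    rw [h4, winOp, ← Finset.sum_sub_distrib]
    refine Finset.sum_congr rfl fun a _ => ?_
    ext i j
    simp [mul_sub]
  rw [h3]
  exact posSemidef_sum _ fun a _ => (posSemidef_Mproj z a).kronecker (h2 _)


theorem qform_vecMulVec_kronecker {ι κ : Type*} [Fintype ι] [Fintype κ] (v : ι → ℂ)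
    (F : Matrix κ κ ℂ) (ψ : ι × κ → ℂ) :
    qform (vecMulVec v (star v) ⊗ₖ (Fᴴ * F)) ψ =
      vnorm (F *ᵥ fun k => ∑ j, star (v j) * ψ (j, k)) ^ 2 := by
  have h : vecMulVec v (star v) ⊗ₖ (Fᴴ * F) =
      (replicateRow Unit (star v) ⊗ₖ F)ᴴ * (replicateRow Unit (star v) ⊗ₖ F) := by
    rw [conjTranspose_kronecker, ← mul_kronecker_mul, vecMulVec_eq Unit,
      conjTranspose_replicateRow, star_star]
  rw [h, qform_conjTranspose_mul_self, vnorm_sq, vnorm_sq, Fintype.sum_prod_type,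
    Fintype.sum_unique]
  refine Finset.sum_congr rfl fun k _ => ?_
  congr 2
  simp only [mulVec, dotProduct, Fintype.sum_prod_type, Finset.mul_sum]
  rw [Finset.sum_comm]
  refine Finset.sum_congr rfl fun j _ => Finset.sum_congr rfl fun k' _ => ?_
  simp only [kronecker_apply, replicateRow_apply, Pi.star_apply]
  ring

/-- Bitwise addition of a fixed bit string, as a permutation. -/
def xorPerm {m : ℕ} (e : Bits m) : Equiv.Perm (Bits m) :=
  Function.Involutive.toPerm (fun a i => xor (e i) (a i)) fun a => by
    funext i
    simp

theorem hammingDist_xorPerm {m : ℕ} (a e : Bits m) : hammingDist a (xorPerm a e) = weight e := by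
  rw [hammingDist, weight]
  congr 1
  refine Finset.filter_congr fun i _ => ?_
  change a i ≠ xor (a i) (e i) ↔ _
  cases a i <;> cases e i <;> simp

theorem xorPerm_comm {m : ℕ} (a e : Bits m) : xorPerm a e = xorPerm e a := by
  funext i
  exact Bool.xor_comm _ _

theorem norm_toEuclideanCLM_apply {ι : Type*} [Fintype ι] [DecidableEq ι] (M : Matrix ι ι ℂ)
    (v : ι → ℂ) : ‖toEuclideanCLM (n := ι) (𝕜 := ℂ) M (WithLp.toLp 2 v)‖ = vnorm (M *ᵥ v) := by
  rw [vnorm, toEuclideanCLM_toLp]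

theorem sum_norm_sq_toEuclideanCLM {ι κ : Type*} [Fintype ι] [DecidableEq ι] [Fintype κ]
    (K : κ → Matrix ι ι ℂ) (hK : ∑ a, (K a)ᴴ * K a = 1) (x : EuclideanSpace ℂ ι) :
    ∑ a, ‖toEuclideanCLM (n := ι) (𝕜 := ℂ) (K a) x‖ ^ 2 = ‖x‖ ^ 2 := by
  obtain ⟨v⟩ := x
  simp_rw [norm_toEuclideanCLM_apply, ← qform_conjTranspose_mul_self]
  rw [← qform_sum, hK, qform_one, vnorm]

theorem adjoint_toEuclideanCLM {ι : Type*} [Fintype ι] [DecidableEq ι] (M : Matrix ι ι ℂ) :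
    ContinuousLinearMap.adjoint (toEuclideanCLM (n := ι) (𝕜 := ℂ) M) =
      toEuclideanCLM (n := ι) (𝕜 := ℂ) Mᴴ := by
  rw [← ContinuousLinearMap.star_eq_adjoint, ← map_star, star_eq_conjTranspose]

/-- Monogamy-of-entanglement bound for measurements with a fixed pattern of errors. -/
theorem sum_qform_xorPerm_le {m : ℕ} {α β : Type*} [Fintype α] [DecidableEq α] [Fintype β]
    [DecidableEq β] {A : Bits m → Bits m → Matrix α α ℂ} {B : Bits m → Bits m → Matrix β β ℂ}
    (hA : ∀ z, IsPOVM (A z)) (hB : ∀ z, IsPOVM (B z)) (e : Bits m)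
    (ψ : Bits m × (α × β) → ℂ) :
    ∑ z, ∑ a, qform (Mproj z a ⊗ₖ (A z (xorPerm e a) ⊗ₖ B z (xorPerm e a))) ψ ≤
      (1 + 1 / Real.sqrt 2) ^ m * vnorm ψ ^ 2 := by
  choose S hS using fun z a => exists_conjTranspose_mul_self ((hA z).1 a)
  choose R hR using fun z a => exists_conjTranspose_mul_self ((hB z).1 a)
  have key := monogamy_bound (H := EuclideanSpace ℂ (α × β))
    (fun z a => toEuclideanCLM (𝕜 := ℂ) (S z (xorPerm e a) ⊗ₖ (1 : Matrix β β ℂ)))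
    (fun z a => toEuclideanCLM (𝕜 := ℂ) ((1 : Matrix α α ℂ) ⊗ₖ R z (xorPerm e a)))
    (fun z x => by
      refine sum_norm_sq_toEuclideanCLM (fun a => S z (xorPerm e a) ⊗ₖ (1 : Matrix β β ℂ)) ?_ x
      rw [Equiv.sum_comp (xorPerm e) fun a => (S z a ⊗ₖ (1 : Matrix β β ℂ))ᴴ *
        (S z a ⊗ₖ (1 : Matrix β β ℂ))]
      simp_rw [conjTranspose_kronecker, ← mul_kronecker_mul, ← hS]
      rw [← kronecker_sum_left, (hA z).2, conjTranspose_one, one_mul, one_kronecker_one])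
    (fun z x => by
      refine sum_norm_sq_toEuclideanCLM (fun a => (1 : Matrix α α ℂ) ⊗ₖ R z (xorPerm e a)) ?_ x
      rw [Equiv.sum_comp (xorPerm e) fun a => ((1 : Matrix α α ℂ) ⊗ₖ R z a)ᴴ *
        ((1 : Matrix α α ℂ) ⊗ₖ R z a)]
      simp_rw [conjTranspose_kronecker, ← mul_kronecker_mul, ← hR]
      rw [← kronecker_sum_right, (hB z).2, conjTranspose_one, one_mul, one_kronecker_one])
    (fun z a z' b => by
      simp only [← map_mul, ← mul_kronecker_mul, one_mul, mul_one])
    (fun z a z' b => by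
      simp only [adjoint_toEuclideanCLM, conjTranspose_kronecker, conjTranspose_one, ← map_mul,
        ← mul_kronecker_mul, one_mul, mul_one])
    (fun j => WithLp.toLp 2 fun k => ψ (j, k))
  have h1 : ∑ j, ‖(WithLp.toLp 2 fun k => ψ (j, k) : EuclideanSpace ℂ (α × β))‖ ^ 2 =
      vnorm ψ ^ 2 := by
    rw [vnorm_sq, Fintype.sum_prod_type]
    exact Finset.sum_congr rfl fun j _ => EuclideanSpace.norm_sq_eq _
  rw [h1] at key
  refine le_of_eq_of_le (Finset.sum_congr rfl fun z _ => Finset.sum_congr rfl fun a _ => ?_) key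
  have h2 : ∑ j, star (bb84Vec z a j) •
      (WithLp.toLp 2 fun k => ψ (j, k) : EuclideanSpace ℂ (α × β)) =
      WithLp.toLp 2 fun k => ∑ j, star (bb84Vec z a j) * ψ (j, k) := by
    ext k
    simp
  rw [h2, ← mul_apply_eq_comp, ← map_mul, norm_toEuclideanCLM_apply,
    ← mul_kronecker_mul, one_mul, mul_one, ← qform_vecMulVec_kronecker, conjTranspose_kronecker,
    ← mul_kronecker_mul, ← hS, ← hR, Mproj]

/-- Parallel repetition of the BB84 monogamy game with a fraction `γ` of errors allowed. -/
theorem sum_qform_winOp_le {γ : ℝ} (hγ0 : 0 ≤ γ) (hγ1 : γ < 1 / 2) {m : ℕ} {α β : Type*}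
    [Fintype α] [DecidableEq α] [Fintype β] [DecidableEq β]
    {A : Bits m → Bits m → Matrix α α ℂ} {B : Bits m → Bits m → Matrix β β ℂ}
    (hA : ∀ z, IsPOVM (A z)) (hB : ∀ z, IsPOVM (B z)) {ψ : Bits m × (α × β) → ℂ}
    (hψ : vnorm ψ ≤ 1) :
    ∑ z, qform (winOp γ z (A z) (B z)) ψ ≤ 2 ^ m * lamGamma γ ^ m := by
  have h1 : ∀ z a, ∑ a' ∈ Finset.univ.filter fun a' : Bits m => (hammingDist a a' : ℝ) ≤ γ * m,
      qform (Mproj z a ⊗ₖ (A z a' ⊗ₖ B z a')) ψ =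
      ∑ e ∈ Finset.univ.filter fun e : Bits m => (weight e : ℝ) ≤ γ * m,
        qform (Mproj z a ⊗ₖ (A z (xorPerm e a) ⊗ₖ B z (xorPerm e a))) ψ := by
    intro z a
    rw [Finset.sum_filter, Finset.sum_filter, ← Equiv.sum_comp (xorPerm a)]
    simp_rw [hammingDist_xorPerm, xorPerm_comm a]
  have h2 : ∑ z, qform (winOp γ z (A z) (B z)) ψ =
      ∑ e ∈ Finset.univ.filter fun e : Bits m => (weight e : ℝ) ≤ γ * m, ∑ z, ∑ a,
        qform (Mproj z a ⊗ₖ (A z (xorPerm e a) ⊗ₖ B z (xorPerm e a))) ψ := by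
    simp_rw [winOp, kronecker_sum_right, qform_sum, h1]
    rw [Finset.sum_comm (γ := Bits m) (s := Finset.filter _ _)]
    exact Finset.sum_congr rfl fun z _ => Finset.sum_comm
  have h3 : (1 + 1 / Real.sqrt 2) ^ m * vnorm ψ ^ 2 ≤ (1 + 1 / Real.sqrt 2) ^ m :=
    mul_le_of_le_one_right (by positivity) (pow_le_one₀ (vnorm_nonneg _) hψ)
  have h4 : 2 ^ m * lamGamma γ ^ m = ((2 : ℝ) ^ binEnt γ) ^ m * (1 + 1 / Real.sqrt 2) ^ m := by
    rw [← mul_pow, ← mul_pow, lamGamma]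
    congr 1
    field_simp
  rw [h2, h4]
  calc _ ≤ ∑ e ∈ Finset.univ.filter fun e : Bits m => (weight e : ℝ) ≤ γ * m,
        (1 + 1 / Real.sqrt 2) ^ m :=
        Finset.sum_le_sum fun e _ => (sum_qform_xorPerm_le hA hB e ψ).trans h3
    _ ≤ _ := by
        rw [Finset.sum_const, nsmul_eq_mul]
        exact mul_le_mul_of_nonneg_right (card_weight_le hγ0 hγ1 m) (by positivity)

theorem exists_isPOVM {m : ℕ} (d : Type*) [Fintype d] [DecidableEq d] :
    ∃ A : Bits m → Matrix d d ℂ, IsPOVM A := by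
  refine ⟨fun a => if a = fun _ => false then 1 else 0, fun a => ?_, by simp⟩
  dsimp only
  split_ifs
  · exact PosSemidef.one
  · exact PosSemidef.zero

/-- The best winning probability in bases `z` achievable from the state `ψ` by local
measurements. -/
def optVal {m : ℕ} {α β : Type*} [Fintype α] [DecidableEq α] [Fintype β] [DecidableEq β]
    (γ : ℝ) (ψ : Bits m × (α × β) → ℂ) (z : Bits m) : ℝ :=
  ⨆ p : {A : Bits m → Matrix α α ℂ // IsPOVM A} × {B : Bits m → Matrix β β ℂ // IsPOVM B},
    qform (winOp γ z p.1.1 p.2.1) ψ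

section optVal

variable {m : ℕ} {α β : Type*} [Fintype α] [DecidableEq α] [Fintype β] [DecidableEq β]
  {γ : ℝ} {ψ : Bits m × (α × β) → ℂ}

theorem qform_winOp_le_one (hψ : vnorm ψ ≤ 1) (z : Bits m) {A : Bits m → Matrix α α ℂ}
    {B : Bits m → Matrix β β ℂ} (hA : IsPOVM A) (hB : IsPOVM B) :
    qform (winOp γ z A B) ψ ≤ 1 :=
  (qform_le_vnorm_sq (posSemidef_one_sub_winOp γ z hA hB) ψ).trans
    (pow_le_one₀ (vnorm_nonneg _) hψ)

theorem qform_winOp_le_optVal (hψ : vnorm ψ ≤ 1) (z : Bits m) {A : Bits m → Matrix α α ℂ}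
    {B : Bits m → Matrix β β ℂ} (hA : IsPOVM A) (hB : IsPOVM B) :
    qform (winOp γ z A B) ψ ≤ optVal γ ψ z :=
  le_ciSup (f := fun p : {A : Bits m → Matrix α α ℂ // IsPOVM A} ×
    {B : Bits m → Matrix β β ℂ // IsPOVM B} => qform (winOp γ z p.1.1 p.2.1) ψ)
    ⟨1, by
      rintro _ ⟨p, rfl⟩
      exact qform_winOp_le_one hψ z p.1.2 p.2.2⟩ (⟨A, hA⟩, ⟨B, hB⟩)

theorem qform_winOp_le_optVal_add (hψ : vnorm ψ ≤ 1) {ψ' : Bits m × (α × β) → ℂ}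
    (hψ' : vnorm ψ' ≤ 1) (z : Bits m) {A : Bits m → Matrix α α ℂ} {B : Bits m → Matrix β β ℂ}
    (hA : IsPOVM A) (hB : IsPOVM B) :
    qform (winOp γ z A B) ψ' ≤ optVal γ ψ z + 2 * vnorm (ψ' - ψ) :=
  (qform_le_add (posSemidef_winOp γ z hA hB) (posSemidef_one_sub_winOp γ z hA hB) hψ' hψ).trans
    (add_le_add_left (qform_winOp_le_optVal hψ z hA hB) _)

theorem optVal_nonneg (z : Bits m) : 0 ≤ optVal γ ψ z :=
  Real.iSup_nonneg fun p => qform_nonneg (posSemidef_winOp γ z p.1.2 p.2.2) ψ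

theorem optVal_le_one (hψ : vnorm ψ ≤ 1) (z : Bits m) : optVal γ ψ z ≤ 1 :=
  Real.iSup_le (fun p => qform_winOp_le_one hψ z p.1.2 p.2.2) zero_le_one

theorem sum_optVal_le (hγ0 : 0 ≤ γ) (hγ1 : γ < 1 / 2) (hψ : vnorm ψ ≤ 1) :
    ∑ z, optVal γ ψ z ≤ 2 ^ m * lamGamma γ ^ m := by
  obtain ⟨A₀, hA₀⟩ := exists_isPOVM (m := m) α
  obtain ⟨B₀, hB₀⟩ := exists_isPOVM (m := m) β
  have : Nonempty ({A : Bits m → Matrix α α ℂ // IsPOVM A} ×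
    {B : Bits m → Matrix β β ℂ // IsPOVM B}) := ⟨(⟨A₀, hA₀⟩, ⟨B₀, hB₀⟩)⟩
  refine le_of_forall_pos_le_add fun δ hδ => ?_
  have h1 : ∀ z, optVal γ ψ z - δ / 2 ^ m < optVal γ ψ z := fun z =>
    sub_lt_self _ (by positivity)
  choose p hp using fun z => exists_lt_of_lt_ciSup (h1 z)
  have h2 := sum_qform_winOp_le hγ0 hγ1 (fun z => (p z).1.2) (fun z => (p z).2.2) hψ
  have h3 := Finset.sum_le_sum fun z (_ : z ∈ Finset.univ) => (hp z).le
  rw [Finset.sum_sub_distrib, Finset.sum_const, Finset.card_univ, nsmul_eq_mul, card_bits,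
    mul_div_cancel₀ _ (by positivity)] at h3
  linarith

end optVal

/-- The state `(1 ⊗ U ⊗ V)φ` after the second and fourth registers have been exchanged. -/
def jointState {m : ℕ} {α α' β β' : Type*} [Fintype α] [Fintype α'] [Fintype β] [Fintype β']
    (φ : Bits m × (α × α') × (β × β') → ℂ)
    (U : Matrix (α × α') (α × α') ℂ) (V : Matrix (β × β') (β × β') ℂ) :
    Bits m × (α × β') × (β × α') → ℂ :=
  fun u => (((1 : Matrix (Bits m) (Bits m) ℂ) ⊗ₖ (U ⊗ₖ V)) *ᵥ φ)
    (u.1, (u.2.1.1, u.2.2.2), (u.2.2.1, u.2.1.2))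

theorem jointState_sub {m : ℕ} {α α' β β' : Type*} [Fintype α] [Fintype α'] [Fintype β]
    [Fintype β'] (φ φ' : Bits m × (α × α') × (β × β') → ℂ)
    (U U' : Matrix (α × α') (α × α') ℂ) (V V' : Matrix (β × β') (β × β') ℂ) :
    jointState φ U V - jointState φ' U' V' =
      jointState φ (U - U') V + (jointState φ U' (V - V') + jointState (φ - φ') U' V') := by
  have h1 : (1 : Matrix (Bits m) (Bits m) ℂ) ⊗ₖ ((U - U') ⊗ₖ V) =
      1 ⊗ₖ (U ⊗ₖ V) - 1 ⊗ₖ (U' ⊗ₖ V) := by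
    ext i j
    simp [sub_mul, mul_sub]
  have h2 : (1 : Matrix (Bits m) (Bits m) ℂ) ⊗ₖ (U' ⊗ₖ (V - V')) =
      1 ⊗ₖ (U' ⊗ₖ V) - 1 ⊗ₖ (U' ⊗ₖ V') := by
    ext i j
    simp [mul_sub]
  funext u
  simp only [jointState, h1, h2, sub_mulVec, mulVec_sub, Pi.sub_apply, Pi.add_apply]
  ring

section L2Operator

open scoped Matrix.Norms.L2Operator

theorem vnorm_mulVec_le {ι κ : Type*} [Fintype ι] [Fintype κ] [DecidableEq κ]
    (M : Matrix ι κ ℂ) (v : κ → ℂ) : vnorm (M *ᵥ v) ≤ ‖M‖ * vnorm v :=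
  l2_opNorm_mulVec M (WithLp.toLp 2 v)

theorem vnorm_kronecker_one_mulVec_le {ι κ : Type*} [Fintype ι] [DecidableEq ι] [Fintype κ]
    [DecidableEq κ] (M : Matrix ι ι ℂ) (v : ι × κ → ℂ) :
    vnorm ((M ⊗ₖ (1 : Matrix κ κ ℂ)) *ᵥ v) ≤ ‖M‖ * vnorm v := by
  refine le_of_sq_le_sq ?_ (mul_nonneg (norm_nonneg _) (vnorm_nonneg _))
  rw [mul_pow, vnorm_sq, vnorm_sq, Fintype.sum_prod_type_right, Fintype.sum_prod_type_right,
    Finset.mul_sum]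
  refine Finset.sum_le_sum fun k _ => ?_
  have h := pow_le_pow_left₀ (vnorm_nonneg _) (vnorm_mulVec_le M fun i => v (i, k)) 2
  rw [mul_pow, vnorm_sq, vnorm_sq] at h
  refine le_of_eq_of_le (Finset.sum_congr rfl fun i _ => ?_) h
  congr 2
  simp [mulVec, dotProduct, Fintype.sum_prod_type, Matrix.one_apply]

theorem vnorm_one_kronecker_mulVec_le {ι κ : Type*} [Fintype ι] [DecidableEq ι] [Fintype κ]
    [DecidableEq κ] (M : Matrix κ κ ℂ) (v : ι × κ → ℂ) :
    vnorm (((1 : Matrix ι ι ℂ) ⊗ₖ M) *ᵥ v) ≤ ‖M‖ * vnorm v := by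
  refine le_of_sq_le_sq ?_ (mul_nonneg (norm_nonneg _) (vnorm_nonneg _))
  rw [mul_pow, vnorm_sq, vnorm_sq, Fintype.sum_prod_type, Fintype.sum_prod_type, Finset.mul_sum]
  refine Finset.sum_le_sum fun i _ => ?_
  have h := pow_le_pow_left₀ (vnorm_nonneg _) (vnorm_mulVec_le M fun k => v (i, k)) 2
  rw [mul_pow, vnorm_sq, vnorm_sq] at h
  refine le_of_eq_of_le (Finset.sum_congr rfl fun k _ => ?_) h
  congr 2
  simp [mulVec, dotProduct, Fintype.sum_prod_type, Matrix.one_apply]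

theorem norm_kronecker_le {ι κ : Type*} [Fintype ι] [DecidableEq ι] [Fintype κ]
    [DecidableEq κ] (M : Matrix ι ι ℂ) (N : Matrix κ κ ℂ) : ‖M ⊗ₖ N‖ ≤ ‖M‖ * ‖N‖ := by
  rw [l2_opNorm_def]
  refine ContinuousLinearMap.opNorm_le_bound _ (by positivity) fun x => ?_
  obtain ⟨v⟩ := x
  change vnorm ((M ⊗ₖ N) *ᵥ v) ≤ ‖M‖ * ‖N‖ * vnorm v
  have h : M ⊗ₖ N = (M ⊗ₖ (1 : Matrix κ κ ℂ)) * ((1 : Matrix ι ι ℂ) ⊗ₖ N) := by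
    rw [← mul_kronecker_mul, one_mul, mul_one]
  rw [h, ← mulVec_mulVec, mul_assoc]
  exact (vnorm_kronecker_one_mulVec_le _ _).trans
    (mul_le_mul_of_nonneg_left (vnorm_one_kronecker_mulVec_le _ _) (norm_nonneg _))

section jointState

variable {m : ℕ} {α α' β β' : Type*} [Fintype α] [Fintype α'] [Fintype β] [Fintype β']
  [DecidableEq α] [DecidableEq α'] [DecidableEq β] [DecidableEq β']

theorem vnorm_jointState_le (φ : Bits m × (α × α') × (β × β') → ℂ)
    (U : Matrix (α × α') (α × α') ℂ) (V : Matrix (β × β') (β × β') ℂ) :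
    vnorm (jointState φ U V) ≤ ‖U‖ * ‖V‖ * vnorm φ := by
  let e : Bits m × (α × β') × (β × α') ≃ Bits m × (α × α') × (β × β') :=
    { toFun := fun u => (u.1, (u.2.1.1, u.2.2.2), (u.2.2.1, u.2.1.2))
      invFun := fun u => (u.1, (u.2.1.1, u.2.2.2), (u.2.2.1, u.2.1.2))
      left_inv := fun _ => rfl
      right_inv := fun _ => rfl }
  have h : vnorm (jointState φ U V) =
      vnorm (((1 : Matrix (Bits m) (Bits m) ℂ) ⊗ₖ (U ⊗ₖ V)) *ᵥ φ) := by
    rw [← sq_eq_sq₀ (vnorm_nonneg _) (vnorm_nonneg _), vnorm_sq, vnorm_sq]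
    exact Equiv.sum_comp e fun i =>
      ‖(((1 : Matrix (Bits m) (Bits m) ℂ) ⊗ₖ (U ⊗ₖ V)) *ᵥ φ) i‖ ^ 2
  rw [h]
  exact (vnorm_one_kronecker_mulVec_le _ _).trans
    (mul_le_mul_of_nonneg_right (norm_kronecker_le U V) (vnorm_nonneg _))

theorem vnorm_jointState_le_one {φ : Bits m × (α × α') × (β × β') → ℂ}
    {U : Matrix (α × α') (α × α') ℂ} {V : Matrix (β × β') (β × β') ℂ} (hφ : vnorm φ ≤ 1)
    (hU : ‖U‖ ≤ 1) (hV : ‖V‖ ≤ 1) : vnorm (jointState φ U V) ≤ 1 :=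
  (vnorm_jointState_le φ U V).trans
    (mul_le_one₀ (mul_le_one₀ hU (norm_nonneg _) hV) (vnorm_nonneg _) hφ)

theorem vnorm_jointState_sub_le {φ φ' : Bits m × (α × α') × (β × β') → ℂ}
    {U U' : Matrix (α × α') (α × α') ℂ} {V V' : Matrix (β × β') (β × β') ℂ} {η : ℝ}
    (hφ : vnorm φ ≤ 1) (hV : ‖V‖ ≤ 1) (hU' : ‖U'‖ ≤ 1) (hV' : ‖V'‖ ≤ 1)
    (hφη : vnorm (φ - φ') ≤ η) (hUη : ‖U - U'‖ ≤ η) (hVη : ‖V - V'‖ ≤ η) :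
    vnorm (jointState φ U V - jointState φ' U' V') ≤ 3 * η := by
  have hη : 0 ≤ η := (norm_nonneg _).trans hUη
  have h1 : vnorm (jointState φ (U - U') V) ≤ η * 1 * 1 :=
    (vnorm_jointState_le _ _ _).trans (mul_le_mul (mul_le_mul hUη hV (norm_nonneg _) hη) hφ
      (vnorm_nonneg _) (by positivity))
  have h2 : vnorm (jointState φ U' (V - V')) ≤ 1 * η * 1 :=
    (vnorm_jointState_le _ _ _).trans (mul_le_mul (mul_le_mul hU' hVη (norm_nonneg _) zero_le_one)
      hφ (vnorm_nonneg _) (by positivity))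
  have h3 : vnorm (jointState (φ - φ') U' V') ≤ 1 * 1 * η :=
    (vnorm_jointState_le _ _ _).trans (mul_le_mul (mul_le_mul hU' hV' (norm_nonneg _) zero_le_one)
      hφη (vnorm_nonneg _) (by positivity))
  rw [jointState_sub]
  have h4 := vnorm_add_le (jointState φ (U - U') V)
    (jointState φ U' (V - V') + jointState (φ - φ') U' V')
  have h5 := vnorm_add_le (jointState φ U' (V - V')) (jointState (φ - φ') U' V')
  linarith

end jointState

/-- Replacing the state and the unitaries of a strategy by nearby contractions, and optimising the
final measurements, changes the winning probability only slightly. -/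
theorem BB84Strategy.win_le {n m q : ℕ} (S : BB84Strategy n m q) (γ : ℝ)
    (f : Bits n × Bits n → Bits m) {η : ℝ}
    {φ : Bits m × (Bits S.qAk × Bits S.qAc) × (Bits S.qBk × Bits S.qBc) → ℂ}
    {U : Bits n → Matrix (Bits S.qAk × Bits S.qAc) (Bits S.qAk × Bits S.qAc) ℂ}
    {V : Bits n → Matrix (Bits S.qBk × Bits S.qBc) (Bits S.qBk × Bits S.qBc) ℂ}
    (hφ : vnorm φ ≤ 1) (hU : ∀ x, ‖U x‖ ≤ 1) (hV : ∀ y, ‖V y‖ ≤ 1)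
    (hφη : vnorm (S.φ - φ) ≤ η) (hUη : ∀ x, ‖S.U x - U x‖ ≤ η)
    (hVη : ∀ y, ‖S.V y - V y‖ ≤ η) :
    S.win γ f ≤ 1 / 2 ^ (2 * n) *
      ∑ p : Bits n × Bits n, optVal γ (jointState φ (U p.1) (V p.2)) (f p) + 6 * η := by
  have hSφ : vnorm S.φ ≤ 1 := by
    refine le_of_sq_le_sq ?_ zero_le_one
    rw [vnorm_sq, S.hφ, one_pow]
  have hSU : ∀ x, ‖S.U x‖ ≤ 1 := fun x => (CStarRing.norm_of_mem_unitary (S.hU x)).le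
  have hSV : ∀ y, ‖S.V y‖ ≤ 1 := fun y => (CStarRing.norm_of_mem_unitary (S.hV y)).le
  have h1 : ∀ p : Bits n × Bits n,
      qform (winOp γ (f p) (S.A p.1 p.2) (S.B p.1 p.2)) (S.psi p.1 p.2) ≤
        optVal γ (jointState φ (U p.1) (V p.2)) (f p) + 6 * η := by
    intro p
    have h2 := qform_winOp_le_optVal_add (γ := γ) (vnorm_jointState_le_one hφ (hU p.1) (hV p.2))
      (vnorm_jointState_le_one hSφ (hSU p.1) (hSV p.2)) (f p) (S.hA p.1 p.2) (S.hB p.1 p.2)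
    have h3 := vnorm_jointState_sub_le hSφ (hSV p.2) (hU p.1) (hV p.2) hφη (hUη p.1) (hVη p.2)
    change qform _ (jointState S.φ (S.U p.1) (S.V p.2)) ≤ _
    linarith
  have h2 : S.win γ f = 1 / 2 ^ (2 * n) * ∑ p : Bits n × Bits n,
      qform (winOp γ (f p) (S.A p.1 p.2) (S.B p.1 p.2)) (S.psi p.1 p.2) := by
    rw [BB84Strategy.win, Fintype.sum_prod_type]
    congr 1
    refine Finset.sum_congr rfl fun x _ => Finset.sum_congr rfl fun y _ => ?_
    rw [winOp, qform_sum]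
    rfl
  have h3 := Finset.sum_le_sum fun p (_ : p ∈ (Finset.univ : Finset (Bits n × Bits n))) => h1 p
  rw [Finset.sum_add_distrib, Finset.sum_const, Finset.card_univ, Fintype.card_prod, nsmul_eq_mul,
    Nat.cast_mul, card_bits] at h3
  rw [h2]
  calc _ ≤ 1 / 2 ^ (2 * n) * (∑ p : Bits n × Bits n,
        optVal γ (jointState φ (U p.1) (V p.2)) (f p) + 2 ^ n * 2 ^ n * (6 * η)) := by
        gcongr
    _ = _ := by
        rw [mul_add, two_mul n, pow_add]
        field_simp

/-- Union bound over nets for the number of functions for which strategies with registers of given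
sizes perform well. -/
theorem card_le_of_win_ge {γ : ℝ} (hγ0 : 0 ≤ γ) (hγ1 : γ < 1 / 2) {n m q k k' l l' : ℕ}
    (hk : k + k' = q) (hl : l + l' = q) {η T θ : ℝ} (hη : 0 < η) (hθ : 0 ≤ θ)
    (s : Finset (Bits n × Bits n → Bits m))
    (hs : ∀ f ∈ s, ∃ S : BB84Strategy n m q, S.qAk = k ∧ S.qAc = k' ∧ S.qBk = l ∧ S.qBc = l' ∧
      T + 6 * η ≤ S.win γ f) :
    (s.card : ℝ) ≤ (1 + 2 / η) ^ (2 * (2 ^ m * 4 ^ q) + 4 * (2 ^ n * 4 ^ q)) *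
      (((2 : ℝ) ^ m) ^ Fintype.card (Bits n × Bits n) *
        Real.exp ((2 ^ n) ^ 2 * (lamGamma γ ^ m * (Real.exp θ - 1) - θ * T))) := by
  classical
  obtain ⟨D, hD⟩ : ∃ D : ℝ, D = ((2 : ℝ) ^ m) ^ Fintype.card (Bits n × Bits n) *
    Real.exp ((2 ^ n) ^ 2 * (lamGamma γ ^ m * (Real.exp θ - 1) - θ * T)) := ⟨_, rfl⟩
  have hD0 : 0 ≤ D := by
    rw [hD]
    positivity
  rw [← hD]
  obtain ⟨sφ, hφ1, hφ2, hφ3⟩ := exists_net_unitBall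
    (EuclideanSpace ℂ (Bits m × (Bits k × Bits k') × (Bits l × Bits l'))) hη
  obtain ⟨sU, hU1, hU2, hU3⟩ := exists_net_unitBall
    (Matrix (Bits k × Bits k') (Bits k × Bits k') ℂ) hη
  obtain ⟨sV, hV1, hV2, hV3⟩ := exists_net_unitBall
    (Matrix (Bits l × Bits l') (Bits l × Bits l') ℂ) hη
  have hcard : ∀ {k k' : ℕ}, k + k' = q → Fintype.card (Bits k × Bits k') = 2 ^ q := by
    intro k k' h
    rw [← h, pow_add]
    simp [Bits]
  have h4 : (4 : ℕ) ^ q = 2 ^ q * 2 ^ q := by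
    rw [← mul_pow]
    norm_num
  rw [finrank_real_of_complex, finrank_euclideanSpace, Fintype.card_prod, Fintype.card_prod,
    hcard hk, hcard hl, ← h4, Fintype.card_fun, Fintype.card_bool, Fintype.card_fin] at hφ3
  rw [finrank_real_of_complex, Module.finrank_matrix, hcard hk, Module.finrank_self, mul_one,
    ← h4] at hU3
  rw [finrank_real_of_complex, Module.finrank_matrix, hcard hl, Module.finrank_self, mul_one,
    ← h4] at hV3
  set R := sφ ×ˢ (Fintype.piFinset fun _ : Bits n => sU) ×ˢ
    (Fintype.piFinset fun _ : Bits n => sV) with hR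
  have hRcard : (R.card : ℝ) ≤ (1 + 2 / η) ^ (2 * (2 ^ m * 4 ^ q) + 4 * (2 ^ n * 4 ^ q)) := by
    rw [hR, Finset.card_product, Finset.card_product, Fintype.card_piFinset,
      Fintype.card_piFinset, Finset.prod_const, Finset.prod_const, Finset.card_univ,
      Fintype.card_fun, Fintype.card_bool, Fintype.card_fin]
    push_cast
    calc _ ≤ (1 + 2 / η) ^ (2 * (2 ^ m * 4 ^ q)) * (((1 + 2 / η) ^ (2 * 4 ^ q)) ^ 2 ^ n *
          ((1 + 2 / η) ^ (2 * 4 ^ q)) ^ 2 ^ n) := by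
          gcongr
      _ = _ := by
          rw [← pow_mul, ← pow_add, ← pow_add]
          congr 1
          ring
  have hcover : s ⊆ R.biUnion fun r => Finset.univ.filter fun f : Bits n × Bits n → Bits m =>
      (Fintype.card (Bits n × Bits n) : ℝ) * T ≤
        ∑ p, optVal γ (jointState r.1.ofLp (r.2.1 p.1) (r.2.2 p.2)) (f p) := by
    intro f hf
    obtain ⟨S, rfl, rfl, rfl, rfl, hS⟩ := hs f hf
    obtain ⟨φ, hφs, hφ⟩ := hφ2 (WithLp.toLp 2 S.φ) (by
      refine le_of_sq_le_sq ?_ zero_le_one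
      rw [EuclideanSpace.norm_sq_eq, one_pow]
      exact S.hφ.le)
    choose U hUs hU using fun x => hU2 (S.U x) (CStarRing.norm_of_mem_unitary (S.hU x)).le
    choose V hVs hV using fun y => hV2 (S.V y) (CStarRing.norm_of_mem_unitary (S.hV y)).le
    refine Finset.mem_biUnion.2 ⟨(φ, U, V), ?_, Finset.mem_filter.2 ⟨Finset.mem_univ _, ?_⟩⟩
    · simp only [hR, Finset.mem_product, Fintype.mem_piFinset]
      exact ⟨hφs, hUs, hVs⟩
    · have h := hS.trans (S.win_le γ f (φ := φ.ofLp) (hφ1 φ hφs) (fun x => hU1 _ (hUs x))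
        (fun y => hV1 _ (hVs y)) hφ hU hV)
      have hN : (Fintype.card (Bits n × Bits n) : ℝ) = 2 ^ (2 * n) := by
        rw [Fintype.card_prod, Nat.cast_mul, card_bits]
        ring
      rw [hN]
      have h5 := le_of_add_le_add_right h
      rw [one_div, inv_mul_eq_div, le_div_iff₀ (by positivity)] at h5
      linarith
  have hbound : ∀ r ∈ R, ((Finset.univ.filter fun f : Bits n × Bits n → Bits m =>
      (Fintype.card (Bits n × Bits n) : ℝ) * T ≤
        ∑ p, optVal γ (jointState r.1.ofLp (r.2.1 p.1) (r.2.2 p.2)) (f p)).card : ℝ) ≤ D := by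
    intro r hr
    simp only [hR, Finset.mem_product, Fintype.mem_piFinset] at hr
    have hψ : ∀ p : Bits n × Bits n,
        vnorm (jointState r.1.ofLp (r.2.1 p.1) (r.2.2 p.2)) ≤ 1 := fun p =>
      vnorm_jointState_le_one (hφ1 _ hr.1) (hU1 _ (hr.2.1 _)) (hV1 _ (hr.2.2 _))
    have h0 : ∀ (p : Bits n × Bits n) (z : Bits m),
        0 ≤ optVal γ (jointState r.1.ofLp (r.2.1 p.1) (r.2.2 p.2)) z := fun p => optVal_nonneg
    have h1 : ∀ (p : Bits n × Bits n) (z : Bits m),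
        optVal γ (jointState r.1.ofLp (r.2.1 p.1) (r.2.2 p.2)) z ≤ 1 := fun p =>
      optVal_le_one (hψ p)
    have h2 : ∀ p : Bits n × Bits n,
        ∑ z, optVal γ (jointState r.1.ofLp (r.2.1 p.1) (r.2.2 p.2)) z ≤
          Fintype.card (Bits m) * lamGamma γ ^ m := fun p => by
      rw [card_bits]
      exact sum_optVal_le hγ0 hγ1 (hψ p)
    have h := card_filter_le_chernoff _ (lamGamma γ ^ m) T θ hθ h0 h1 h2
      (Finset.univ.filter fun f : Bits n × Bits n → Bits m =>
        (Fintype.card (Bits n × Bits n) : ℝ) * T ≤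
          ∑ p, optVal γ (jointState r.1.ofLp (r.2.1 p.1) (r.2.2 p.2)) (f p))
      (fun f hf => (Finset.mem_filter.1 hf).2)
    rw [card_bits] at h
    refine h.trans_eq ?_
    rw [hD, Fintype.card_prod, Nat.cast_mul, card_bits, sq]
  have hs1 : (s.card : ℝ) ≤ R.card * D := by
    refine le_trans ?_ ((Finset.sum_le_card_nsmul _ _ _ hbound).trans_eq (nsmul_eq_mul _ _))
    exact_mod_cast (Finset.card_le_card hcover).trans Finset.card_biUnion_le
  exact hs1.trans (mul_le_mul_of_nonneg_right hRcard hD0)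

end L2Operator

theorem two_rpow_sub_mul_logb {u : ℝ} (hu : 0 < u) (n : ℕ) (t : ℝ) :
    (2 : ℝ) ^ ((n : ℝ) - t * Real.logb 2 (1 / u)) = 2 ^ n * u ^ t := by
  have h : (2 : ℝ) ^ (Real.logb 2 u) = u := Real.rpow_logb two_pos (by norm_num) hu
  rw [one_div, Real.logb_inv, mul_neg, sub_neg_eq_add, Real.rpow_add two_pos, Real.rpow_natCast,
    mul_comm t, Real.rpow_mul two_pos.le, h]

/-- The bound on the number of qubits in multiplicative form. -/
theorem four_pow_lt_of_two_mul_lt {lam Δ c : ℝ} (hlam : 0 < lam) (hΔ : 0 < Δ)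
    (hu : lam + Δ < 1) (hc1 : c < 1) {n m q : ℕ}
    (hq : 2 * (q : ℝ) < (n : ℝ) - c * m * Real.logb 2 (1 / (lam + Δ)) +
      Real.logb 2 ((1 - (lam + Δ) ^ ((1 : ℝ) - c)) * Real.logb 2 ((lam + Δ) / lam) /
        (8 * Real.logb 2 (1 / Δ)))) :
    8 * Real.log (1 / Δ) * 4 ^ q < 2 ^ n * (lam + Δ) ^ (c * (m : ℝ)) *
      (1 - (lam + Δ) ^ ((1 : ℝ) - c)) * Real.log ((lam + Δ) / lam) := by
  have hlog2 : 0 < Real.log 2 := Real.log_pos one_lt_two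
  have hL : 0 < Real.log (1 / Δ) := Real.log_pos (by rw [lt_div_iff₀ hΔ]; linarith)
  have hG : 0 < Real.log ((lam + Δ) / lam) := Real.log_pos (by rw [lt_div_iff₀ hlam]; linarith)
  have h1 : 0 < 1 - (lam + Δ) ^ ((1 : ℝ) - c) :=
    sub_pos.2 (Real.rpow_lt_one (by linarith) hu (by linarith))
  have hK : (1 - (lam + Δ) ^ ((1 : ℝ) - c)) * Real.logb 2 ((lam + Δ) / lam) /
      (8 * Real.logb 2 (1 / Δ)) =
      (1 - (lam + Δ) ^ ((1 : ℝ) - c)) * Real.log ((lam + Δ) / lam) /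
      (8 * Real.log (1 / Δ)) := by
    rw [← Real.log_div_log, ← Real.log_div_log]
    field_simp
  have h2 := Real.rpow_lt_rpow_of_exponent_lt one_lt_two hq
  rw [hK, Real.rpow_add two_pos, two_rpow_sub_mul_logb (by linarith),
    Real.rpow_logb two_pos (by norm_num) (by positivity), Real.rpow_mul two_pos.le,
    Real.rpow_natCast] at h2
  norm_num only [Real.rpow_ofNat] at h2
  rw [← mul_div_assoc, lt_div_iff₀ (by positivity)] at h2
  linarith

theorem four_pow_lt_two_pow {lam Δ c : ℝ} (hlam : 3 / 4 ≤ lam) (hΔ : 0 < Δ)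
    (hu : lam + Δ < 1) (hc0 : 0 < c) {n m q : ℕ}
    (hq : 8 * Real.log (1 / Δ) * 4 ^ q < 2 ^ n * (lam + Δ) ^ (c * (m : ℝ)) *
      (1 - (lam + Δ) ^ ((1 : ℝ) - c)) * Real.log ((lam + Δ) / lam)) :
    4 ^ q < 2 ^ n := by
  have hu0 : 0 < lam + Δ := by linarith
  have hL : 3 / 4 ≤ Real.log (1 / Δ) := by
    have := Real.one_sub_inv_le_log_of_pos (one_div_pos.2 hΔ)
    rw [one_div, inv_inv] at this
    rw [one_div]
    linarith
  have hG : Real.log ((lam + Δ) / lam) ≤ 1 := by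
    refine (Real.log_le_sub_one_of_pos (by positivity)).trans ?_
    rw [sub_le_iff_le_add, div_le_iff₀ (by linarith)]
    linarith
  have hG0 : 0 ≤ Real.log ((lam + Δ) / lam) :=
    Real.log_nonneg (by rw [le_div_iff₀ (by linarith)]; linarith)
  have hT : (lam + Δ) ^ (c * (m : ℝ)) ≤ 1 := Real.rpow_le_one hu0.le hu.le (by positivity)
  have hV : 1 - (lam + Δ) ^ ((1 : ℝ) - c) ≤ 1 := by
    have := Real.rpow_nonneg hu0.le ((1 : ℝ) - c)
    linarith
  have h1 : 2 ^ n * (lam + Δ) ^ (c * (m : ℝ)) *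
      (1 - (lam + Δ) ^ ((1 : ℝ) - c)) * Real.log ((lam + Δ) / lam) ≤ 2 ^ n := by
    have h2 : 2 ^ n * (lam + Δ) ^ (c * (m : ℝ)) ≤ 2 ^ n := mul_le_of_le_one_right (by positivity) hT
    have h3 : 2 ^ n * (lam + Δ) ^ (c * (m : ℝ)) * (1 - (lam + Δ) ^ ((1 : ℝ) - c)) ≤ 2 ^ n :=
      (mul_le_of_le_one_right (by positivity) hV).trans h2
    calc _ ≤ 2 ^ n * Real.log ((lam + Δ) / lam) := mul_le_mul_of_nonneg_right h3 hG0
      _ ≤ _ := mul_le_of_le_one_right (by positivity) hG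
  have h4 : (4 : ℝ) ^ q < 2 ^ n := by
    have : (0 : ℝ) < 4 ^ q := by positivity
    nlinarith
  exact_mod_cast h4

/-- The Chernoff exponent, for the exponential tilt `((lam + Δ) / lam) ^ m`. -/
theorem chernoff_exponent_le {lam Δ c : ℝ} (hlam : 0 < lam) (hΔ : 0 < Δ)
    (hu : lam + Δ < 1) (hc1 : c < 1) {m : ℕ} (hm : 0 < m) :
    lam ^ m * (Real.exp (m * Real.log ((lam + Δ) / lam)) - 1) -
      m * Real.log ((lam + Δ) / lam) * (lam + Δ) ^ (c * (m : ℝ)) ≤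
    -((lam + Δ) ^ (c * (m : ℝ)) * (1 - (lam + Δ) ^ ((1 : ℝ) - c)) *
      (m * Real.log ((lam + Δ) / lam))) := by
  have hu0 : 0 < lam + Δ := by linarith
  have hx : 0 < (lam + Δ) / lam := by positivity
  have hG0 : 0 ≤ m * Real.log ((lam + Δ) / lam) :=
    mul_nonneg m.cast_nonneg (Real.log_nonneg (by rw [le_div_iff₀ hlam]; linarith))
  have he : Real.exp (m * Real.log ((lam + Δ) / lam)) = ((lam + Δ) / lam) ^ m := by
    rw [Real.exp_nat_mul, Real.exp_log hx]
  have h1 : lam ^ m * (((lam + Δ) / lam) ^ m - 1) =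
      (lam + Δ) ^ m * (1 - (((lam + Δ) / lam) ^ m)⁻¹) := by
    rw [div_pow]
    field_simp
  have h2 : 1 - (((lam + Δ) / lam) ^ m)⁻¹ ≤ m * Real.log ((lam + Δ) / lam) := by
    have := Real.one_sub_inv_le_log_of_pos (pow_pos hx m)
    rwa [Real.log_pow] at this
  have h3 : (lam + Δ) ^ m ≤ (lam + Δ) ^ (c * (m : ℝ)) * (lam + Δ) ^ ((1 : ℝ) - c) := by
    rw [← Real.rpow_add hu0, ← Real.rpow_natCast]
    refine Real.rpow_le_rpow_of_exponent_ge hu0 hu.le ?_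
    have : (1 : ℝ) ≤ m := by exact_mod_cast hm
    nlinarith
  rw [he, h1]
  have h4 := mul_le_mul_of_nonneg_left h2 (pow_pos hu0 m).le
  have h5 := mul_le_mul_of_nonneg_right h3 hG0
  linarith

/-- Number of functions for which strategies with registers of given sizes win with probability
exceeding the threshold. -/
theorem card_le_div_of_win_ge {γ : ℝ} (hγ0 : 0 ≤ γ) (hγ1 : γ < 1 / 2) {Δ c : ℝ} (hΔ : 0 < Δ)
    (hu : lamGamma γ + Δ < 1) (hc1 : c < 1) {n m q k k' l l' : ℕ} (hm : 0 < m)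
    (hnm : m < n) (hk : k + k' = q) (hl : l + l' = q)
    (hq : 8 * Real.log (1 / Δ) * 4 ^ q < 2 ^ n * (lamGamma γ + Δ) ^ (c * (m : ℝ)) *
      (1 - (lamGamma γ + Δ) ^ ((1 : ℝ) - c)) * Real.log ((lamGamma γ + Δ) / lamGamma γ))
    (s : Finset (Bits n × Bits n → Bits m))
    (hs : ∀ f ∈ s, ∃ S : BB84Strategy n m q, S.qAk = k ∧ S.qAc = k' ∧ S.qBk = l ∧ S.qBc = l' ∧
      (lamGamma γ + Δ) ^ (c * (m : ℝ)) + 18 * Δ ^ m ≤ S.win γ f) :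
    (s.card : ℝ) ≤ ((2 : ℝ) ^ m) ^ Fintype.card (Bits n × Bits n) / 2 ^ (6 * (m * 2 ^ n)) := by
  have hlam := lamGamma_ge hγ0 hγ1
  have hlam0 : 0 < lamGamma γ := by linarith
  have hm' : (1 : ℝ) ≤ m := by exact_mod_cast hm
  have hθ : 0 ≤ m * Real.log ((lamGamma γ + Δ) / lamGamma γ) :=
    mul_nonneg m.cast_nonneg (Real.log_nonneg (by rw [le_div_iff₀ hlam0]; linarith))
  have h := card_le_of_win_ge hγ0 hγ1 hk hl (η := 3 * Δ ^ m)
    (T := (lamGamma γ + Δ) ^ (c * (m : ℝ))) (by positivity) hθ s (fun f hf => by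
      obtain ⟨S, h1, h2, h3, h4, h5⟩ := hs f hf
      exact ⟨S, h1, h2, h3, h4, by linarith⟩)
  refine h.trans ?_
  have hL : 2 * Real.log 2 ≤ Real.log (1 / Δ) := by
    rw [← Real.log_rpow two_pos]
    refine Real.log_le_log (by positivity) ?_
    rw [le_div_iff₀ hΔ]
    norm_num
    linarith
  have hlog2 : 0 < Real.log 2 := Real.log_pos one_lt_two
  have hnet : 1 + 2 / (3 * Δ ^ m) ≤ Real.exp (m * Real.log (1 / Δ)) := by
    have h1 : Δ ^ m ≤ 1 / 4 := (pow_le_of_le_one hΔ.le (by linarith) hm.ne').trans (by linarith)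
    have h2 : 0 < Δ ^ m := by positivity
    rw [Real.exp_nat_mul, Real.exp_log (by positivity), div_pow, one_pow]
    have h3 : 1 / Δ ^ m - (1 + 2 / (3 * Δ ^ m)) = (1 / 3 - Δ ^ m) / Δ ^ m := by
      field_simp
      ring
    have h4 : 0 ≤ (1 / 3 - Δ ^ m) / Δ ^ m := div_nonneg (by linarith) h2.le
    linarith
  have hexp : 2 * (2 ^ m * 4 ^ q) + 4 * (2 ^ n * 4 ^ q) ≤ 5 * (2 ^ n * 4 ^ q) := by
    have h1 : 2 * 2 ^ m ≤ 2 ^ n := by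
      rw [← pow_succ']
      exact Nat.pow_le_pow_right two_pos hnm
    nlinarith [Nat.mul_le_mul_right (4 ^ q) h1]
  have hone : 1 ≤ 1 + 2 / (3 * Δ ^ m) := le_add_of_nonneg_right (by positivity)
  have hnets : (1 + 2 / (3 * Δ ^ m)) ^ (2 * (2 ^ m * 4 ^ q) + 4 * (2 ^ n * 4 ^ q)) ≤
      Real.exp (5 * (2 ^ n * 4 ^ q) * (m * Real.log (1 / Δ))) := by
    refine (pow_le_pow_right₀ hone hexp).trans ((pow_le_pow_left₀ (by positivity) hnet _).trans ?_)
    rw [← Real.exp_nat_mul]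
    push_cast
    rfl
  have hch := chernoff_exponent_le hlam0 hΔ hu hc1 hm
  have hN : (0 : ℝ) < 2 ^ n := by positivity
  have hfin : Real.exp (5 * (2 ^ n * 4 ^ q) * (m * Real.log (1 / Δ))) *
      Real.exp ((2 ^ n) ^ 2 * (lamGamma γ ^ m *
        (Real.exp (m * Real.log ((lamGamma γ + Δ) / lamGamma γ)) - 1) -
        m * Real.log ((lamGamma γ + Δ) / lamGamma γ) * (lamGamma γ + Δ) ^ (c * (m : ℝ)))) ≤
      (2 ^ (6 * (m * 2 ^ n)))⁻¹ := by
    rw [← Real.exp_add]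
    have h2 : ((2 : ℝ) ^ (6 * (m * 2 ^ n)))⁻¹ =
        Real.exp (-(6 * (m * 2 ^ n) * Real.log 2)) := by
      rw [Real.exp_neg, ← Real.exp_log (pow_pos two_pos _), Real.log_pow]
      push_cast
      rfl
    rw [h2]
    refine Real.exp_le_exp.2 ?_
    have h3 := mul_le_mul_of_nonneg_left hch (sq_nonneg ((2 : ℝ) ^ n))
    have h4 := mul_le_mul_of_nonneg_left hq.le (mul_nonneg hN.le (m.cast_nonneg (α := ℝ)))
    have h5 : (1 : ℝ) ≤ 4 ^ q := one_le_pow₀ (by norm_num)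
    have h6 : 2 * Real.log 2 ≤ Real.log (1 / Δ) * 4 ^ q := by nlinarith
    have h7 := mul_le_mul_of_nonneg_left h6 (mul_nonneg hN.le (m.cast_nonneg (α := ℝ)))
    linarith
  calc _ ≤ Real.exp (5 * (2 ^ n * 4 ^ q) * (m * Real.log (1 / Δ))) *
        (((2 : ℝ) ^ m) ^ Fintype.card (Bits n × Bits n) * _) :=
        mul_le_mul_of_nonneg_right hnets (by positivity)
    _ = ((2 : ℝ) ^ m) ^ Fintype.card (Bits n × Bits n) *
        (Real.exp (5 * (2 ^ n * 4 ^ q) * (m * Real.log (1 / Δ))) * _) := mul_left_comm _ _ _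
    _ ≤ _ := by
        rw [div_eq_mul_inv]
        exact mul_le_mul_of_nonneg_left hfin (by positivity)

/-- parallel repetition soundness of `QPV_BB84^{f:n→m}` in the bounded
entanglement model, for a uniformly random `f ∈ F*_ε`. -/
theorem stmt10 (γ : ℝ) (hγ0 : 0 ≤ γ) (hγ1 : γ < 1 / 2) (n m : ℕ) (hnm : n > m)
    (ε Δ c : ℝ) (hε0 : 0 < ε) (hε : ε ≤ (2 : ℝ) ^ (-(m : ℝ) - 1))
    (hΔ0 : 0 < Δ) (hΔ1 : Δ < 1) (hlam : lamGamma γ + Δ < 1)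
    (hc0 : 0 < c) (hc1 : c < 1)
    (hregime : Real.sqrt (3 * Real.log (2 / ε)) * (2 : ℝ) ^ (-(n : ℝ) + m / 2) < 1 / 4) :
    (1 - (2 : ℝ) ^ (-(m : ℝ) *
          (2 : ℝ) ^ ((n : ℝ) - c * m * Real.logb 2 (1 / (lamGamma γ + Δ))))) *
        ((Fstar n m ε).ncard : ℝ) ≤
      (({f ∈ Fstar n m ε |
          ∀ q : ℕ,
            2 * (q : ℝ) < (n : ℝ) - c * m * Real.logb 2 (1 / (lamGamma γ + Δ)) +
                Real.logb 2 ((1 - (lamGamma γ + Δ) ^ ((1 : ℝ) - c)) *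
                  Real.logb 2 ((lamGamma γ + Δ) / lamGamma γ) /
                    (8 * Real.logb 2 (1 / Δ))) →
              ∀ S : BB84Strategy n m q,
                S.win γ f ≤ (lamGamma γ + Δ) ^ (c * (m : ℝ)) *
                    (1 + 3 * Real.sqrt (3 * Real.log (2 / ε)) *
                      (2 : ℝ) ^ (-(n : ℝ) + m / 2)) +
                  21 * Δ ^ m}).ncard : ℝ) := by
  classical
  have hlam34 := lamGamma_ge hγ0 hγ1
  have hu0 : 0 < lamGamma γ + Δ := by linarith
  rcases Nat.eq_zero_or_pos m with rfl | hm
  · simp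
  rw [two_rpow_sub_mul_logb hu0]
  set P : (Bits n × Bits n → Bits m) → Prop := fun f => ∀ q : ℕ,
    2 * (q : ℝ) < (n : ℝ) - c * m * Real.logb 2 (1 / (lamGamma γ + Δ)) +
        Real.logb 2 ((1 - (lamGamma γ + Δ) ^ ((1 : ℝ) - c)) *
          Real.logb 2 ((lamGamma γ + Δ) / lamGamma γ) / (8 * Real.logb 2 (1 / Δ))) →
      ∀ S : BB84Strategy n m q,
        S.win γ f ≤ (lamGamma γ + Δ) ^ (c * (m : ℝ)) *
            (1 + 3 * Real.sqrt (3 * Real.log (2 / ε)) * (2 : ℝ) ^ (-(n : ℝ) + m / 2)) +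
          21 * Δ ^ m with hP
  change _ ≤ (({f ∈ Fstar n m ε | P f}).ncard : ℝ)
  set D := ((2 : ℝ) ^ m) ^ Fintype.card (Bits n × Bits n) with hD
  set T := (lamGamma γ + Δ) ^ (c * (m : ℝ)) with hT
  have hD0 : 0 < D := by positivity
  have hT0 : 0 < T := Real.rpow_pos_of_pos hu0 _
  have hT1 : T ≤ 1 := Real.rpow_le_one hu0.le hlam.le (by positivity)
  let bad : Finset (Bits n × Bits n → Bits m) := Finset.univ.filter fun f => ¬ P f
  let piece : ℕ × ℕ × ℕ → Finset (Bits n × Bits n → Bits m) := fun t =>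
    Finset.univ.filter fun f =>
      8 * Real.log (1 / Δ) * 4 ^ t.1 < 2 ^ n * T * (1 - (lamGamma γ + Δ) ^ ((1 : ℝ) - c)) *
        Real.log ((lamGamma γ + Δ) / lamGamma γ) ∧
      ∃ S : BB84Strategy n m t.1, S.qAk = t.2.1 ∧ S.qBk = t.2.2 ∧ T + 18 * Δ ^ m ≤ S.win γ f
  have hpiece : ∀ t, ((piece t).card : ℝ) ≤ D / 2 ^ (6 * (m * 2 ^ n)) := by
    intro t
    rcases (piece t).eq_empty_or_nonempty with h | ⟨f, hf⟩
    · rw [h]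
      simp only [Finset.card_empty, Nat.cast_zero]
      positivity
    · obtain ⟨hq, S, hA, hB, -⟩ := (Finset.mem_filter.1 hf).2
      have hk := S.hqA
      have hl := S.hqB
      refine card_le_div_of_win_ge hγ0 hγ1 hΔ0 hlam hc1 hm hnm (hA ▸ hk) (hB ▸ hl) hq _ ?_
      intro g hg
      obtain ⟨-, S', hA', hB', h'⟩ := (Finset.mem_filter.1 hg).2
      have hk' := S'.hqA
      have hl' := S'.hqB
      exact ⟨S', hA', by omega, hB', by omega, h'⟩
  have hcover : bad ⊆ (Finset.range (2 ^ n) ×ˢ Finset.range (2 ^ n) ×ˢ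
      Finset.range (2 ^ n)).biUnion piece := by
    intro f hf
    have hf' := (Finset.mem_filter.1 hf).2
    simp only [hP, not_forall, not_le] at hf'
    obtain ⟨q, hq, S, hS⟩ := hf'
    have hq' := four_pow_lt_of_two_mul_lt (by linarith) hΔ0 hlam hc1 hq
    have hq2 : q < 2 ^ n := (Nat.lt_pow_self (by norm_num)).trans
      (four_pow_lt_two_pow hlam34 hΔ0 hlam hc0 hq')
    have hk := S.hqA
    have hl := S.hqB
    refine Finset.mem_biUnion.2 ⟨(q, S.qAk, S.qBk), ?_, ?_⟩
    · simp only [Finset.mem_product, Finset.mem_range]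
      omega
    · refine Finset.mem_filter.2 ⟨Finset.mem_univ _, hq', S, rfl, rfl, ?_⟩
      have h1 : 0 ≤ T * (3 * Real.sqrt (3 * Real.log (2 / ε)) *
        (2 : ℝ) ^ (-(n : ℝ) + m / 2)) := by positivity
      have h2 : 0 < Δ ^ m := by positivity
      linarith
  have hbad : (bad.card : ℝ) ≤ ((Fstar n m ε).ncard : ℝ) * ((2 : ℝ) ^ (m * 2 ^ n))⁻¹ := by
    have h1 : (bad.card : ℝ) ≤ ((2 : ℝ) ^ n * (2 ^ n * 2 ^ n)) * (D / 2 ^ (6 * (m * 2 ^ n))) := by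
      have h2 : (bad.card : ℝ) ≤ ∑ t ∈ Finset.range (2 ^ n) ×ˢ Finset.range (2 ^ n) ×ˢ
          Finset.range (2 ^ n), ((piece t).card : ℝ) := by
        exact_mod_cast (Finset.card_le_card hcover).trans Finset.card_biUnion_le
      refine (h2.trans (Finset.sum_le_card_nsmul _ _ _ fun t _ => hpiece t)).trans_eq ?_
      rw [nsmul_eq_mul, Finset.card_product, Finset.card_product, Finset.card_range]
      push_cast
      rfl
    have h3 : D ≤ 2 * ((Fstar n m ε).ncard : ℝ) := card_le_two_mul_ncard_Fstar hε0 hε hregime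
    have hn : n ≤ m * 2 ^ n := Nat.lt_two_pow_self.le.trans (Nat.le_mul_of_pos_left _ hm)
    have h4 : (2 : ℝ) ^ n ≤ 2 ^ (m * 2 ^ n) := pow_le_pow_right₀ one_le_two hn
    have h5 : (2 : ℝ) ≤ 2 ^ (m * 2 ^ n) := by
      refine (le_self_pow₀ one_le_two ?_)
      positivity
    set Q := (2 : ℝ) ^ (m * 2 ^ n) with hQ
    have hQ0 : 0 < Q := by positivity
    have h6 : (2 : ℝ) ^ (6 * (m * 2 ^ n)) = Q ^ 6 := by rw [mul_comm, pow_mul]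
    rw [h6] at h1
    have hF : (0 : ℝ) ≤ ((Fstar n m ε).ncard : ℝ) := Nat.cast_nonneg _
    calc (bad.card : ℝ) ≤ _ := h1
      _ ≤ (Q * (Q * Q)) * (2 * ((Fstar n m ε).ncard : ℝ) / Q ^ 6) := by gcongr
      _ ≤ (Q * (Q * Q)) * (Q * ((Fstar n m ε).ncard : ℝ) / Q ^ 6) := by gcongr
      _ = ((Fstar n m ε).ncard : ℝ) * Q⁻¹ * Q⁻¹ := by field_simp
      _ ≤ _ := mul_le_of_le_one_right (by positivity) (inv_le_one_of_one_le₀ (by linarith))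
  have hexp : ((2 : ℝ) ^ (m * 2 ^ n))⁻¹ ≤ (2 : ℝ) ^ (-(m : ℝ) * (2 ^ n * T)) := by
    rw [← Real.rpow_natCast, ← Real.rpow_neg two_pos.le]
    refine Real.rpow_le_rpow_of_exponent_le one_le_two ?_
    push_cast
    have h1 : (m : ℝ) * 2 ^ n * T ≤ m * 2 ^ n := mul_le_of_le_one_right (by positivity) hT1
    linarith
  have hsplit : ((Fstar n m ε).ncard : ℝ) ≤ (({f ∈ Fstar n m ε | P f}).ncard : ℝ) + bad.card := by
    rw [← Set.ncard_coe_finset]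
    have h1 : Fstar n m ε ⊆ {f ∈ Fstar n m ε | P f} ∪ (bad : Set _) := fun f hf => by
      by_cases h : P f
      · exact Or.inl ⟨hf, h⟩
      · exact Or.inr (by simpa [bad] using h)
    exact_mod_cast (Set.ncard_le_ncard h1 (Set.toFinite _)).trans (Set.ncard_union_le _ _)
  have h := mul_le_mul_of_nonneg_left hexp (Nat.cast_nonneg (α := ℝ) (Fstar n m ε).ncard)
  linarith
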